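/- Let f : S¹×S¹ → ℝ be a smooth function that vanishes exactly on the diagonal {(x,x)} and is positive elsewhere, with 0 a regular value of ∂f/∂y away from the diagonal, so that the critical set Z = {(x,y) : ∂f/∂y = 0} is a finite disjoint union of simple closed curves. Then Z contains an even number of homotopically essential simple closed curves. -/

import Mathlib

section TorusCurves

open Complex

lemma exists_continuous_log (f : ℝ × ℝ → ℂ) (hf : Continuous f) (h0 : ∀ p, f p ≠ 0) :
    ∃ L : ℝ × ℝ → ℂ, Continuous L ∧ ∀ p, exp (L p) = f p := by
  obtain ⟨L, ⟨-, hL⟩, -⟩ := isCoveringMap_exp.existsUnique_continuousMap_lifts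
    (A := ℝ × ℝ) ⟨fun p => ⟨f p, h0 p⟩, by fun_prop⟩ 0 (log (f 0))
    (Subtype.ext (exp_log (h0 0)))
  exact ⟨L, L.continuous, fun p => congrArg Subtype.val (congrFun hL p)⟩

lemma exists_lift_addCircle {X : Type*} [TopologicalSpace X] [SimplyConnectedSpace X]
    [LocallyPathConnectedSpace X] (f : X → AddCircle (1 : ℝ)) (hf : Continuous f) :
    ∃ L : X → ℝ, Continuous L ∧ ∀ x, (L x : AddCircle (1 : ℝ)) = f x := by
  obtain ⟨x₀⟩ : Nonempty X := inferInstance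
  obtain ⟨e, he⟩ := QuotientAddGroup.mk_surjective (f x₀)
  obtain ⟨L, ⟨-, hL⟩, -⟩ := (AddCircle.isCoveringMap_coe (1 : ℝ)).existsUnique_continuousMap_lifts
    ⟨f, hf⟩ x₀ e he
  exact ⟨L, L.continuous, fun p => congrFun hL p⟩

lemma coe_addCircle_eq_iff (x y : ℝ) :
    (x : AddCircle (1 : ℝ)) = y ↔ ∃ n : ℤ, x = y + n := by
  rw [eq_comm, QuotientAddGroup.eq, AddSubgroup.mem_zmultiples_iff]
  constructor
  · rintro ⟨n, hn⟩
    exact ⟨n, by simp at hn; linarith⟩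
  · rintro ⟨n, hn⟩
    exact ⟨n, by simp; linarith⟩

lemma eq_const_of_forall_int {X : Type*} [TopologicalSpace X] [PreconnectedSpace X] [Nonempty X]
    (f : X → ℝ) (hf : Continuous f) (h : ∀ x, ∃ n : ℤ, f x = n) :
    ∃ n : ℤ, ∀ x, f x = n := by
  choose g hg using h
  have hg' : Continuous g := by
    rw [Int.isClosedEmbedding_coe_real.isInducing.continuous_iff]
    exact hf.congr hg
  obtain ⟨x₀⟩ := ‹Nonempty X›
  refine ⟨g x₀, fun x => ?_⟩
  rw [hg x, PreconnectedSpace.constant ‹_› hg' (x := x) (y := x₀)]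

lemma exp_eq_const_shift {X : Type*} [TopologicalSpace X] [PreconnectedSpace X] [Nonempty X]
    (f g : X → ℂ) (hf : Continuous f) (hg : Continuous g) (h : ∀ x, exp (f x) = exp (g x)) :
    ∃ n : ℤ, ∀ x, f x = g x + n * (2 * Real.pi * I) := by
  have h' : ∀ x, ∃ n : ℤ, f x = g x + n * (2 * Real.pi * I) := fun x => exp_eq_exp_iff_exists_int.1 (h x)
  have key : ∀ x, ∀ n : ℤ, f x = g x + n * (2 * Real.pi * I) ↔
      f x = g x + ((f x - g x).im / (2 * Real.pi) : ℝ) * (2 * Real.pi * I) ∧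
      (f x - g x).im / (2 * Real.pi) = n := by
    intro x n
    constructor
    · intro hx
      have : (f x - g x).im / (2 * Real.pi) = n := by
        rw [hx]; simp
      exact ⟨by rw [this]; simpa using hx, this⟩
    · rintro ⟨h1, h2⟩
      rw [h2] at h1
      simpa using h1
  obtain ⟨n, hn⟩ := eq_const_of_forall_int (fun x => (f x - g x).im / (2 * Real.pi))
    (by fun_prop) (fun x => (h' x).imp fun n hn => ((key x n).1 hn).2)
  refine ⟨n, fun x => (key x n).2 ⟨?_, hn x⟩⟩
  obtain ⟨m, hm⟩ := h' x
  exact ((key x m).1 hm).1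

lemma winding_eq (l u w : ℝ → ℂ) (hl : Continuous l) (hu : Continuous u) (hw : Continuous w)
    (hw1 : ∀ t, ‖w t‖ < 1) (hwp : ∀ t, w (t + 1) = w t)
    (h : ∀ t, exp (l t) = exp (2 * Real.pi * I * u t) * (1 - w t)) (n a : ℤ)
    (hln : ∀ t, l (t + 1) = l t + n * (2 * Real.pi * I)) (hua : ∀ t, u (t + 1) = u t + a) :
    n = a := by
  have hs : ∀ t, 1 - w t ∈ slitPlane := fun t => by
    have := mem_slitPlane_of_norm_lt_one (z := - w t) (by simpa using hw1 t)
    rwa [← sub_eq_add_neg] at this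
  obtain ⟨m, hm⟩ := exp_eq_const_shift l (fun t => 2 * Real.pi * I * u t + log (1 - w t)) hl
    (by
      have : Continuous fun t => log (1 - w t) :=
        Continuous.clog (by fun_prop) hs
      fun_prop)
    (fun t => by rw [exp_add, exp_log (slitPlane_ne_zero (hs t)), h])
  have h1 := hm 0
  have h2 := hm (0 + 1)
  rw [hln, hua, hwp, h1] at h2
  have h3 : ((n : ℂ) - a) * (2 * Real.pi * I) = 0 := by linear_combination h2
  have h4 : (n : ℂ) - a = 0 := by
    simpa [Real.pi_ne_zero] using h3
  exact_mod_cast sub_eq_zero.1 h4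

end TorusCurves

section TorusCurves

open Set Topology

lemma exists_preconnected_superlevel {E : Type*} [NormedAddCommGroup E] [NormedSpace ℝ E]
    {g : E → ℝ} {l : E →L[ℝ] ℝ} {q : E} (hg : HasStrictFDerivAt g l q) (h0 : g q = 0) (hl : l ≠ 0)
    {N : Set E} (hN : N ∈ 𝓝 q) :
    q ∈ closure (N ∩ {p | 0 < g p}) ∧
      ∃ W ∈ 𝓝 q, ∃ C, IsPreconnected C ∧ C ⊆ N ∩ {p | 0 < g p} ∧ W ∩ {p | 0 < g p} ⊆ C := by
  obtain ⟨e, he⟩ : ∃ e, l e = 1 := by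
    obtain ⟨v, hv⟩ := DFunLike.ne_iff.1 hl
    exact ⟨(l v)⁻¹ • v, by simpa using inv_mul_cancel₀ hv⟩
  have he0 : 0 < ‖e‖ := norm_pos_iff.2 fun h => by simp [h] at he
  set c : NNReal := ⟨1 / (2 * ‖e‖), by positivity⟩ with hc
  have hc0 : (c : ℝ) * ‖e‖ = 1 / 2 := by
    change 1 / (2 * ‖e‖) * ‖e‖ = 1 / 2
    field_simp
  have hcpos : 0 < c := by
    rw [← NNReal.coe_pos]
    change 0 < 1 / (2 * ‖e‖)
    positivity
  obtain ⟨s, hs, hap⟩ := hg.approximates_deriv_on_nhds (Or.inr hcpos)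
  obtain ⟨r, hr, hrs⟩ := Metric.mem_nhds_iff.1 (Filter.inter_mem hs hN)
  have up : ∀ p t, p ∈ Metric.ball q r → p + t • e ∈ Metric.ball q r → 0 ≤ t →
      g p + t / 2 ≤ g (p + t • e) := by
    intro p t hp hpt ht
    have := hap _ (hrs hpt).1 _ (hrs hp).1
    rw [add_sub_cancel_left, map_smul, he, norm_smul, Real.norm_eq_abs, Real.norm_eq_abs,
      abs_of_nonneg ht, mul_left_comm, hc0] at this
    have := (abs_le.1 this).1
    simp at this
    linarith
  set D : ℝ := ‖l‖ + c with hD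
  have hDpos : 0 < D := by
    have := norm_nonneg l
    have : (0 : ℝ) < c := hcpos
    positivity
  have low : ∀ p ∈ Metric.ball q r, -(D * ‖p - q‖) ≤ g p := by
    intro p hp
    have h1 := hap _ (hrs hp).1 _ (hrs (Metric.mem_ball_self hr)).1
    rw [h0, sub_zero, Real.norm_eq_abs] at h1
    have h2 := (abs_le.1 h1).1
    have h3 := (abs_le.1 (l.le_opNorm (p - q))).1
    rw [hD, add_mul]
    linarith
  set t₀ : ℝ := r / (2 * ‖e‖) with ht₀
  have ht₀e : t₀ * ‖e‖ = r / 2 := by rw [ht₀]; field_simp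
  have ht₀pos : 0 < t₀ := by positivity
  set ρ : ℝ := min (r / 2) (t₀ / (4 * D)) with hρ
  have hρpos : 0 < ρ := by positivity
  have hρ1 : ρ ≤ r / 2 := min_le_left _ _
  have hρ2 : D * ρ ≤ t₀ / 4 := by
    calc D * ρ ≤ D * (t₀ / (4 * D)) := by gcongr; exact min_le_right _ _
      _ = t₀ / 4 := by field_simp
  have mem : ∀ p ∈ Metric.ball q ρ, ∀ t, 0 ≤ t → t ≤ t₀ → p + t • e ∈ Metric.ball q r := by
    intro p hp t ht htt
    rw [mem_ball_iff_norm] at hp ⊢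
    calc ‖p + t • e - q‖ = ‖(p - q) + t • e‖ := by congr 1; abel
      _ ≤ ‖p - q‖ + t * ‖e‖ := by
        refine (norm_add_le _ _).trans ?_
        rw [norm_smul, Real.norm_eq_abs, abs_of_nonneg ht]
      _ ≤ ‖p - q‖ + t₀ * ‖e‖ := by gcongr
      _ < r := by rw [ht₀e]; linarith
  have mem0 : ∀ p ∈ Metric.ball q ρ, p ∈ Metric.ball q r := fun p hp =>
    Metric.ball_subset_ball (by linarith) hp
  have topc : ∀ p ∈ Metric.ball q ρ, 0 < g (p + t₀ • e) := by
    intro p hp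
    have h1 := up p t₀ (mem0 p hp) (mem p hp t₀ ht₀pos.le le_rfl) ht₀pos.le
    have h2 := low p (mem0 p hp)
    rw [mem_ball_iff_norm] at hp
    have h3 : D * ‖p - q‖ ≤ D * ρ := by gcongr
    linarith
  constructor
  · rw [mem_closure_iff_nhds]
    intro t ht
    have hlim : Filter.Tendsto (fun s : ℝ => q + s • e) (𝓝[>] 0) (𝓝 q) := by
      have : Continuous fun s : ℝ => q + s • e := by fun_prop
      simpa using (this.tendsto 0).mono_left (nhdsWithin_le_nhds (s := Ioi 0))
    have h1 := hlim.eventually (Filter.inter_mem ht hN)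
    have h2 : ∀ᶠ s : ℝ in 𝓝[>] 0, s ∈ Ioc 0 t₀ := Ioc_mem_nhdsGT ht₀pos
    obtain ⟨s, hs1, hs2⟩ := (h1.and h2).exists
    have hq := Metric.mem_ball_self (x := q) hρpos
    have := up q s (mem0 q hq) (mem q hq s hs2.1.le hs2.2) hs2.1.le
    refine ⟨_, hs1.1, hs1.2, ?_⟩
    change 0 < g _
    have := hs2.1
    linarith
  · set T : Set E := (fun w => w + t₀ • e) '' Metric.ball q ρ with hT
    have hTc : IsPreconnected T :=
      (convex_ball q ρ).isPreconnected.image _ (by fun_prop)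
    have hTsub : T ⊆ N ∩ {p | 0 < g p} := by
      rintro _ ⟨w, hw, rfl⟩
      exact ⟨(hrs (mem w hw t₀ ht₀pos.le le_rfl)).2, topc w hw⟩
    refine ⟨Metric.ball q ρ, Metric.ball_mem_nhds _ hρpos,
      T ∪ ⋃ p ∈ Metric.ball q ρ ∩ {p | 0 < g p}, (fun t : ℝ => p + t • e) '' Icc 0 t₀, ?_, ?_, ?_⟩
    · refine isPreconnected_of_forall (q + t₀ • e) ?_
      rintro y (hy | hy)
      · exact ⟨T, subset_union_left, ⟨q, Metric.mem_ball_self hρpos, rfl⟩, hy, hTc⟩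
      · simp only [mem_iUnion] at hy
        obtain ⟨p, hp, hy⟩ := hy
        refine ⟨T ∪ (fun t : ℝ => p + t • e) '' Icc 0 t₀, ?_,
          Or.inl ⟨q, Metric.mem_ball_self hρpos, rfl⟩, Or.inr hy, ?_⟩
        · refine union_subset_union_right _ ?_
          exact subset_iUnion₂_of_subset p hp subset_rfl
        · refine IsPreconnected.union (p + t₀ • e) ⟨p, hp.1, rfl⟩
            ⟨t₀, ⟨ht₀pos.le, le_rfl⟩, rfl⟩ hTc ?_
          exact isPreconnected_Icc.image _ (by fun_prop)
    · refine union_subset hTsub (iUnion₂_subset ?_)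
      rintro p ⟨hp, hp0⟩ _ ⟨t, ht, rfl⟩
      refine ⟨(hrs (mem p hp t ht.1 ht.2)).2, ?_⟩
      have := up p t (mem0 p hp) (mem p hp t ht.1 ht.2) ht.1
      change 0 < g _
      have h3 : 0 < g p := hp0
      have := ht.1
      linarith
    · intro p hp
      refine Or.inr (mem_iUnion₂.2 ⟨p, hp, 0, ⟨le_rfl, ht₀pos.le⟩, by simp⟩)

lemma exists_path_of_locally_connected_superlevel {h : ℝ × ℝ → ℝ} (hc : Continuous h)
    (hper : ∀ p, ∀ m : ℤ, h (p + ((m : ℝ), 0)) = h p) {c : ℝ → ℝ × ℝ} (hcc : Continuous c)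
    (hzero : ∀ p, h p = 0 → ∃ t, ∃ m : ℤ, p = c t + ((m : ℝ), 0)) (hcz : ∀ t, h (c t) = 0)
    (hloc : ∀ q, h q = 0 → q ∈ closure {p | 0 < h p} ∧
      ∃ W ∈ 𝓝 q, ∃ C, IsPreconnected C ∧ C ⊆ {p | 0 < h p} ∧ W ∩ {p | 0 < h p} ⊆ C)
    (hbot : ∀ u, 0 < h (u, 0)) (htop : 0 < h (0, 1)) :
    ∃ d : ℝ → ℝ × ℝ, Continuous d ∧ d 0 = (0, 0) ∧ d 1 = (0, 1) ∧ ∀ s, 0 < h (d s) := by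
  set P : Set (ℝ × ℝ) := {p | 0 < h p} with hP
  have hPo : IsOpen P := isOpen_lt continuous_const hc
  set V := connectedComponentIn P (0, 0) with hV
  have h00 : ((0 : ℝ), (0 : ℝ)) ∈ P := hbot 0
  have hVo : IsOpen V := hPo.connectedComponentIn
  have hVc : IsConnected V := isConnected_connectedComponentIn_iff.2 h00
  have hVP : V ⊆ P := connectedComponentIn_subset _ _
  have hV0 : ((0 : ℝ), (0 : ℝ)) ∈ V := mem_connectedComponentIn h00
  have habsorb : ∀ C, IsPreconnected C → C ⊆ P → (C ∩ V).Nonempty → C ⊆ V := by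
    rintro C hC hCP ⟨x, hx, hxV⟩
    rw [hV, connectedComponentIn_eq hxV]
    exact hC.subset_connectedComponentIn hx hCP
  have htrans : ∀ m : ℤ, ∀ p ∈ V, p + ((m : ℝ), 0) ∈ V := by
    intro m p hp
    have hline : range (fun u : ℝ => (u, (0 : ℝ))) ⊆ V := by
      refine habsorb _ (isPreconnected_range (by fun_prop)) ?_ ⟨(0, 0), ⟨0, rfl⟩, hV0⟩
      rintro _ ⟨u, rfl⟩
      exact hbot u
    have himg : (fun p : ℝ × ℝ => p + ((m : ℝ), 0)) '' V ⊆ V := by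
      refine habsorb _ (hVc.isPreconnected.image _ (by fun_prop)) ?_ ⟨((m : ℝ), 0), ⟨(0, 0), hV0, by simp⟩, hline ⟨m, rfl⟩⟩
      rintro _ ⟨x, hx, rfl⟩
      change 0 < h _
      rw [hper]
      exact hVP hx
    exact himg ⟨p, hp, rfl⟩
  have hlocV : ∀ q, h q = 0 → q ∈ closure V → ∃ W ∈ 𝓝 q, W ∩ P ⊆ V := by
    intro q hq hqV
    obtain ⟨-, W, hW, C, hC, hCP, hWC⟩ := hloc q hq
    refine ⟨W, hW, hWC.trans (habsorb C hC hCP ?_)⟩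
    obtain ⟨x, hxW, hxV⟩ := mem_closure_iff_nhds.1 hqV W hW
    exact ⟨x, hWC ⟨hxW, hVP hxV⟩, hxV⟩
  have hJ : IsClopen {t | c t ∈ closure V} := by
    refine ⟨isClosed_closure.preimage hcc, ?_⟩
    rw [isOpen_iff_mem_nhds]
    intro t ht
    obtain ⟨W, hW, hWV⟩ := hlocV _ (hcz t) ht
    filter_upwards [hcc.continuousAt.preimage_mem_nhds (interior_mem_nhds.2 hW)] with t' ht'
    rw [mem_closure_iff_nhds]
    intro S hS
    obtain ⟨x, hx, hxP⟩ := mem_closure_iff_nhds.1 (hloc _ (hcz t')).1 _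
      (Filter.inter_mem hS (mem_interior_iff_mem_nhds.1 ht'))
    exact ⟨x, hx.1, hWV ⟨hx.2, hxP⟩⟩
  have hclV : ∀ p ∈ closure V, 0 ≤ h p := fun p hp =>
    closure_minimal (fun x hx => (hVP hx).le) (isClosed_le continuous_const hc) hp
  have hrel : ∀ p ∈ closure V, 0 < h p → p ∈ V := by
    intro p hp hp0
    obtain ⟨x, hx, hxV⟩ := mem_closure_iff_nhds.1 hp _
      ((hPo.connectedComponentIn (x := p)).mem_nhds (mem_connectedComponentIn hp0))
    have h1 := connectedComponentIn_eq hx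
    have h2 := connectedComponentIn_eq hxV
    rw [hV, h2, ← h1]
    exact mem_connectedComponentIn hp0
  have hmem : ((0 : ℝ), (1 : ℝ)) ∈ V := by
    rcases isClopen_iff.1 hJ with hJ | hJ
    · have hcl : IsClopen V := by
        refine ⟨closure_subset_iff_isClosed.1 fun p hp => hrel p hp ?_, hVo⟩
        refine lt_of_le_of_ne (hclV p hp) fun h0 => ?_
        obtain ⟨t, m, rfl⟩ := hzero p h0.symm
        have : c t ∈ closure V := by
          rw [mem_closure_iff_nhds] at hp ⊢
          intro S hS
          have hcont : ContinuousAt (fun x : ℝ × ℝ => x + (((-m : ℤ) : ℝ), 0)) (c t + ((m : ℝ), 0)) := by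
            fun_prop
          obtain ⟨x, hx, hxV⟩ := hp _ (hcont.preimage_mem_nhds (t := S) (by
            convert hS using 2
            ext <;> simp))
          exact ⟨_, hx, htrans _ _ hxV⟩
        have : t ∈ (∅ : Set ℝ) := hJ ▸ this
        exact this
      rw [(isClopen_iff.1 hcl).resolve_left (Set.Nonempty.ne_empty ⟨_, hV0⟩)]
      trivial
    · by_contra hnot
      have hcl : IsClopen (P \ V) := by
        constructor
        · refine closure_subset_iff_isClosed.1 fun p hp => ?_
          have hpV : p ∉ V := fun hpV => by
            obtain ⟨x, hx, hx'⟩ := mem_closure_iff_nhds.1 hp _ (hVo.mem_nhds hpV)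
            exact hx'.2 hx
          have hp0 : 0 ≤ h p :=
            closure_minimal (fun x hx => (show 0 < h x from hx.1).le)
              (isClosed_le continuous_const hc) hp
          refine ⟨lt_of_le_of_ne hp0 fun h0 => ?_, hpV⟩
          obtain ⟨t, m, rfl⟩ := hzero p h0.symm
          have hct : t ∈ {t | c t ∈ closure V} := hJ ▸ mem_univ t
          have hcl' : c t + ((m : ℝ), 0) ∈ closure V := by
            have hm : MapsTo (fun x : ℝ × ℝ => x + ((m : ℝ), 0)) V V := fun x hx => htrans m x hx
            exact hm.closure (by fun_prop) hct
          obtain ⟨W, hW, hWV⟩ := hlocV _ h0.symm hcl'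
          obtain ⟨x, hx, hx'⟩ := mem_closure_iff_nhds.1 hp _ hW
          exact hx'.2 (hWV ⟨hx, hx'.1⟩)
        · rw [isOpen_iff_mem_nhds]
          rintro p ⟨hpP, hpV⟩
          have : p ∉ closure V := fun hp => hpV (hrel p hp hpP)
          filter_upwards [hPo.mem_nhds hpP, isClosed_closure.isOpen_compl.mem_nhds this] with x hx hx'
          exact ⟨hx, fun h => hx' (subset_closure h)⟩
      have : P \ V = univ := (isClopen_iff.1 hcl).resolve_left
        (Set.Nonempty.ne_empty ⟨((0 : ℝ), (1 : ℝ)), htop, hnot⟩)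
      have h1 : ((0 : ℝ), (0 : ℝ)) ∈ P \ V := this ▸ mem_univ _
      exact h1.2 hV0
  have hpath := (hVo.isConnected_iff_isPathConnected.1 hVc).joinedIn _ hV0 _ hmem
  refine ⟨hpath.somePath.extend, hpath.somePath.continuous_extend, by simp, by simp, fun s => ?_⟩
  exact hVP (hpath.somePath_mem _)

/-- Near `q`, the set where `h` is positive accumulates at `q` and is locally connected there. -/
def SuperlevelConnectedAt {E : Type*} [TopologicalSpace E] (h : E → ℝ) (q : E) : Prop :=
  ∀ N ∈ 𝓝 q, q ∈ closure (N ∩ {p | 0 < h p}) ∧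
    ∃ W ∈ 𝓝 q, ∃ C, IsPreconnected C ∧ C ⊆ N ∩ {p | 0 < h p} ∧ W ∩ {p | 0 < h p} ⊆ C

lemma SuperlevelConnectedAt.congr {E : Type*} [TopologicalSpace E] {h g : E → ℝ} {q : E}
    (hh : SuperlevelConnectedAt h q) (hg : ∀ᶠ p in 𝓝 q, (0 < h p ↔ 0 < g p)) :
    SuperlevelConnectedAt g q := by
  intro N hN
  obtain ⟨h1, W, hW, C, hC, hCN, hWC⟩ := hh _ (Filter.inter_mem hN hg)
  refine ⟨closure_mono ?_ h1, _, Filter.inter_mem hW hg, C, hC, fun p hp => ?_, fun p hp => ?_⟩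
  · rintro p ⟨⟨hp1, hp2⟩, hp3⟩
    exact ⟨hp1, hp2.1 hp3⟩
  · obtain ⟨⟨hp1, hp2⟩, hp3⟩ := hCN hp
    exact ⟨hp1, hp2.1 hp3⟩
  · exact hWC ⟨hp.1.1, hp.1.2.2 hp.2⟩

lemma forall_pos_or_forall_neg {X : Type*} [TopologicalSpace X] [PreconnectedSpace X]
    {f : X → ℝ} (hf : Continuous f) (h0 : ∀ x, f x ≠ 0) : (∀ x, 0 < f x) ∨ ∀ x, f x < 0 := by
  by_contra! hcon
  obtain ⟨⟨x, hx⟩, y, hy⟩ := hcon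
  obtain ⟨z, hz⟩ := intermediate_value_univ x y hf ⟨hx, hy⟩
  exact h0 z hz

lemma eq_zero_of_superlevel_joins {h : ℝ × ℝ → ℝ} (hc : Continuous h)
    (hper : ∀ p, ∀ m : ℤ, h (p + ((m : ℝ), 0)) = h p) {c : ℝ → ℝ × ℝ} (hcc : Continuous c)
    (hc01 : ∀ t, (c t).2 ∈ Ioo (0 : ℝ) 1)
    (hzero : ∀ p : ℝ × ℝ, p.2 ∈ Icc (0 : ℝ) 1 →
      (h p = 0 ↔ ∃ t, ∃ m : ℤ, p = c t + ((m : ℝ), 0)))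
    {a : ℤ} (hca : ∀ t, c (t + 1) = c t + ((a : ℝ), 0))
    (hloc : ∀ q, h q = 0 → SuperlevelConnectedAt h q)
    (hbot : ∀ u, 0 < h (u, 0)) (htop : 0 < h (0, 1)) : a = 0 := by
  set g : ℝ × ℝ → ℝ := fun p => h (p.1, projIcc (0 : ℝ) 1 zero_le_one p.2) with hg
  have hgc : Continuous g := by
    have : Continuous fun p : ℝ × ℝ => ((projIcc (0 : ℝ) 1 zero_le_one p.2 : Icc (0 : ℝ) 1) : ℝ) :=
      continuous_subtype_val.comp (continuous_projIcc.comp continuous_snd)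
    exact hc.comp (continuous_fst.prodMk this)
  have hgh : ∀ p : ℝ × ℝ, p.2 ∈ Icc (0 : ℝ) 1 → g p = h p := by
    intro p hp
    simp only [hg, projIcc_of_mem zero_le_one hp]
  have hgper : ∀ p, ∀ m : ℤ, g (p + ((m : ℝ), 0)) = g p := by
    intro p m
    have := hper (p.1, projIcc (0 : ℝ) 1 zero_le_one p.2) m
    simpa [hg] using this
  have hgc0 : ∀ t, g (c t) = 0 := fun t => by
    rw [hgh _ (Ioo_subset_Icc_self (hc01 t)), hzero _ (Ioo_subset_Icc_self (hc01 t))]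
    exact ⟨t, 0, by simp⟩
  have hgzero : ∀ p, g p = 0 → ∃ t, ∃ m : ℤ, p = c t + ((m : ℝ), 0) := by
    intro p hp
    obtain ⟨t, m, htm⟩ := (hzero (p.1, projIcc (0 : ℝ) 1 zero_le_one p.2) (Subtype.coe_prop _)).1 hp
    have h2 : ((projIcc (0 : ℝ) 1 zero_le_one p.2 : Icc (0 : ℝ) 1) : ℝ) = (c t).2 := by
      simpa using congrArg Prod.snd htm
    have h3 : p.2 ∈ Icc (0 : ℝ) 1 := by
      have h4 := hc01 t
      rw [← h2, coe_projIcc] at h4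
      obtain ⟨h5, h6⟩ := h4
      have h7 : 0 < min 1 p.2 := by
        by_contra h8
        rw [max_eq_left (not_lt.1 h8)] at h5
        exact lt_irrefl _ h5
      rw [max_eq_right h7.le] at h6
      refine ⟨(lt_of_lt_of_le h7 (min_le_right _ _)).le, ?_⟩
      by_contra h8
      rw [min_eq_left (not_le.1 h8).le] at h6
      exact lt_irrefl _ h6
    rw [projIcc_of_mem zero_le_one h3] at htm
    exact ⟨t, m, htm⟩
  have hstrip : ∀ q, g q = 0 → q.2 ∈ Ioo (0 : ℝ) 1 := by
    intro q hq
    obtain ⟨t, m, rfl⟩ := hgzero q hq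
    simpa using hc01 t
  obtain ⟨d, hd, hd0, hd1, hdpos⟩ := exists_path_of_locally_connected_superlevel hgc hgper hcc
    hgzero hgc0 (fun q hq => by
      have hq' := hstrip q hq
      have hN : Prod.snd ⁻¹' Ioo (0 : ℝ) 1 ∈ 𝓝 q :=
        (isOpen_Ioo.preimage continuous_snd).mem_nhds hq'
      have := (hloc q (by rw [← hgh q (Ioo_subset_Icc_self hq'), hq])).congr (g := g) (by
        filter_upwards [hN] with p hp
        rw [hgh p (Ioo_subset_Icc_self hp)])
      obtain ⟨h1, W, hW, C, hC, hCN, hWC⟩ := this _ hN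
      exact ⟨closure_mono inter_subset_right h1, W, hW, C, hC, hCN.trans inter_subset_right, hWC⟩)
    (fun u => by rw [hgh _ (by simp)]; exact hbot u) (by rw [hgh _ (by simp)]; exact htop)
  set z : ℝ × ℝ → ℂ := fun p => p.1 + Complex.I * p.2 with hz
  have hzc : Continuous z := by fun_prop
  set e : ℝ × ℝ → ℂ := fun p => Complex.exp (2 * Real.pi * Complex.I * z p) with he
  have hec : Continuous e := by fun_prop
  have heq : ∀ p q, e p = e q → ∃ n : ℤ, p = q + ((n : ℝ), 0) := by
    intro p q hpq
    obtain ⟨n, hn⟩ := Complex.exp_eq_exp_iff_exists_int.1 hpq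
    refine ⟨n, ?_⟩
    have : 2 * Real.pi * Complex.I * (z p - (z q + n)) = 0 := by linear_combination hn
    have : z p = z q + n := by
      simpa [Real.pi_ne_zero, sub_eq_zero] using this
    have h1 := congrArg Complex.re this
    have h2 := congrArg Complex.im this
    simp [hz] at h1 h2
    ext <;> simp [h1, h2]
  have hnorm : ∀ p, ‖e p‖ = Real.exp (-(2 * Real.pi * p.2)) := by
    intro p
    simp [he, hz, Complex.norm_exp]
  have heper : ∀ t, e (c (t + 1)) = e (c t) := by
    intro t
    rw [he]
    refine Complex.exp_eq_exp_iff_exists_int.2 ⟨a, ?_⟩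
    simp [hz, hca]
    ring
  obtain ⟨L, hL, hLe⟩ := exists_continuous_log (fun p => e (c p.1) - e (d p.2)) (by fun_prop) (by
    intro p hp
    obtain ⟨n, hn⟩ := heq _ _ (sub_eq_zero.1 hp)
    have h1 := hdpos p.2
    rw [← hgper _ n, ← hn, hgc0] at h1
    exact lt_irrefl _ h1)
  obtain ⟨n, hn⟩ := exp_eq_const_shift (fun p : ℝ × ℝ => L (p.1 + 1, p.2)) L (by fun_prop) hL
    (fun p => by rw [hLe, hLe, heper])
  have hna : n = a := by
    refine winding_eq (fun t => L (t, 1)) (fun t => z (c t)) (fun t => e (d 1) / e (c t))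
      (by fun_prop) (by fun_prop) ?_ ?_ ?_ ?_ n a (fun t => hn (t, 1)) ?_
    · exact Continuous.div continuous_const (by fun_prop) fun t => Complex.exp_ne_zero _
    · intro t
      rw [norm_div, hnorm, hnorm, div_lt_one (Real.exp_pos _), hd1, Real.exp_lt_exp]
      have := (hc01 t).2
      have := Real.pi_pos
      nlinarith
    · intro t
      rw [heper]
    · intro t
      rw [hLe]
      have : e (c t) ≠ 0 := Complex.exp_ne_zero _
      change _ = e (c t) * _
      field_simp
    · intro t
      simp [hz, hca]
      ring
  have hn0 : n = 0 := by
    refine winding_eq (fun t => L (t, 0)) (fun t => 1 / 2) (fun t => e (c t))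
      (by fun_prop) (by fun_prop) (by fun_prop) ?_ heper ?_ n 0 (fun t => hn (t, 0)) (by simp)
    · intro t
      rw [hnorm, Real.exp_lt_one_iff]
      have := (hc01 t).1
      have := Real.pi_pos
      nlinarith
    · intro t
      rw [hLe]
      have h1 : Complex.exp (2 * Real.pi * Complex.I * (1 / 2)) = -1 := by
        rw [← Complex.exp_pi_mul_I]
        congr 1
        ring
      have h2 : e (d 0) = 1 := by simp [he, hz, hd0]
      change e (c t) - e (d 0) = _
      rw [h1, h2]
      ring
  rw [← hna, hn0]

lemma mul_neg_of_ne_zero {h : ℝ × ℝ → ℝ} (hc : Continuous h)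
    (hper : ∀ p, ∀ m : ℤ, h (p + ((m : ℝ), 0)) = h p) {c : ℝ → ℝ × ℝ} (hcc : Continuous c)
    (hc01 : ∀ t, (c t).2 ∈ Ioo (0 : ℝ) 1)
    (hzero : ∀ p : ℝ × ℝ, p.2 ∈ Icc (0 : ℝ) 1 →
      (h p = 0 ↔ ∃ t, ∃ m : ℤ, p = c t + ((m : ℝ), 0)))
    {a : ℤ} (hca : ∀ t, c (t + 1) = c t + ((a : ℝ), 0))
    (hloc : ∀ q, h q = 0 → SuperlevelConnectedAt h q)
    (hloc' : ∀ q, h q = 0 → SuperlevelConnectedAt (fun p => - h p) q)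
    (ha : a ≠ 0) : h (0, 0) * h (0, 1) < 0 := by
  have hb : ∀ v : ℝ, (v = 0 ∨ v = 1) → ∀ u, h (u, v) ≠ 0 := by
    intro v hv u hu
    obtain ⟨t, m, htm⟩ := (hzero (u, v) (by rcases hv with rfl | rfl <;> simp)).1 hu
    have h1 : v = (c t).2 := by simpa using congrArg Prod.snd htm
    have h2 := hc01 t
    rw [← h1] at h2
    rcases hv with rfl | rfl <;> simp at h2
  by_contra hcon
  have h0 := hb 0 (Or.inl rfl)
  have h1 := hb 1 (Or.inr rfl) 0
  rcases forall_pos_or_forall_neg (f := fun u => h (u, 0)) (by fun_prop) h0 with hp | hn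
  · have htop : 0 < h (0, 1) := by
      have := hp 0
      refine lt_of_le_of_ne (not_lt.1 fun h2 => hcon ?_) h1.symm
      exact mul_neg_of_pos_of_neg this h2
    exact ha (eq_zero_of_superlevel_joins hc hper hcc hc01 hzero hca hloc hp htop)
  · have htop : h (0, 1) < 0 := by
      have := hn 0
      refine lt_of_le_of_ne (not_lt.1 fun h2 => hcon ?_) h1
      exact mul_neg_of_neg_of_pos this h2
    exact ha (eq_zero_of_superlevel_joins (h := fun p => - h p) hc.neg (fun p m => by rw [hper])
      hcc hc01 (fun p hp => by rw [neg_eq_zero, hzero p hp]) hca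
      (fun q hq => hloc' q (neg_eq_zero.1 hq)) (fun u => by linarith [hn u])
      (by linarith))

lemma not_neg_pos_of_extension {h : ℝ × ℝ → ℝ} (hc : Continuous h)
    (hper : ∀ p, ∀ m : ℤ, h (p + ((m : ℝ), 0)) = h p)
    {E : ℝ × ℝ → ℝ} (hE : Continuous E) (hEper : ∀ p, E (p + (1, 0)) = E p)
    (hEz : ∀ p : ℝ × ℝ, p.2 ∈ Icc (0 : ℝ) 1 → h p = 0 → ∃ n : ℤ, E p = p.1 + n)
    (hbot : ∀ u, h (u, 0) < 0) (htop : ∀ u, 0 < h (u, 1)) : False := by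
  set k : ℝ × ℝ → ℝ × ℝ := fun p => (p.1, projIcc (0 : ℝ) 1 zero_le_one p.2) with hk
  have hkc : Continuous k :=
    continuous_fst.prodMk (continuous_subtype_val.comp (continuous_projIcc.comp continuous_snd))
  have hk1 : ∀ u v, k (u + 1, v) = k (u, v) + (1, 0) := fun u v => by simp [hk]
  have hk2 : ∀ u, k (u, 0) = (u, 0) := fun u => by simp [hk]
  have hk3 : ∀ u, k (u, 1) = (u, 1) := fun u => by simp [hk]
  have hper1 : ∀ p, h (p + (1, 0)) = h p := fun p => by simpa using hper p 1
  obtain ⟨L, hL, hLe⟩ := exists_continuous_log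
    (fun p => if h (k p) ≤ 0 then Complex.exp (2 * Real.pi * Complex.I * p.1)
      else Complex.exp (2 * Real.pi * Complex.I * E (k p)))
    (by
      refine Continuous.if_le (by fun_prop) (by fun_prop) (by fun_prop) continuous_const ?_
      intro p hp
      obtain ⟨n, hn⟩ := hEz (k p) (Subtype.coe_prop _) hp
      refine (Complex.exp_eq_exp_iff_exists_int.2 ⟨n, ?_⟩).symm
      rw [hn]
      push_cast
      ring)
    (fun p => by split_ifs <;> exact Complex.exp_ne_zero _)
  obtain ⟨n, hn⟩ := exp_eq_const_shift (fun p : ℝ × ℝ => L (p.1 + 1, p.2)) L (by fun_prop) hL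
    (fun p => by
      rw [hLe, hLe, hk1, hper1, hEper]
      split_ifs
      · refine Complex.exp_eq_exp_iff_exists_int.2 ⟨1, ?_⟩
        push_cast
        ring
      · rfl)
  have h1 : n = 1 := by
    refine winding_eq (fun t => L (t, 0)) (fun t => t) (fun t => 0)
      (by fun_prop) (by fun_prop) (by fun_prop) (by simp) (by simp) ?_ n 1 (fun t => hn (t, 0))
      (by simp)
    intro t
    rw [hLe, if_pos (by rw [hk2]; exact (hbot t).le)]
    simp
  have h0 : n = 0 := by
    refine winding_eq (fun t => L (t, 1)) (fun t => E (t, 1)) (fun t => 0)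
      (by fun_prop) (by fun_prop) (by fun_prop) (by simp) (by simp) ?_ n 0 (fun t => hn (t, 1)) ?_
    · intro t
      rw [hLe, if_neg (by rw [hk3]; exact not_le.2 (htop t)), hk3]
      simp
    · intro t
      have := hEper (t, 1)
      simp at this
      simp [this]
  omega

lemma even_sum_of_shift {k : ℕ} (i₀ : Fin k) {G : ℝ × ℝ → ℝ} {r A : Fin k → ℝ × ℝ → ℝ}
    (hA : ∀ i, Continuous (A i)) (hr : ∀ i p, 0 < r i p)
    (hG : ∀ i p, G p = r i p * Real.sin (A i p))
    (hdisj : ∀ i j p, i ≠ j → Real.sin (A i p / 2) = 0 → Real.sin (A j p / 2) ≠ 0)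
    (hG0 : ∀ p, G p = 0 → ∃ i, Real.sin (A i p / 2) = 0)
    {e : ℝ × ℝ} {q : Fin k → ℤ} (hGe : ∀ p, G (p + e) = G p)
    (hAe : ∀ i p, A i (p + e) = A i p + 2 * Real.pi * q i) {p₀ : ℝ × ℝ} (hp₀ : G p₀ ≠ 0) :
    Even (∑ i, q i) := by
  classical
  set S : Fin k → ℝ × ℝ → ℝ := fun i p => Real.sin (A i p / 2) with hS
  have hSc : ∀ i, Continuous (S i) := fun i => by fun_prop
  set R : Fin k → ℝ × ℝ → ℝ := fun i p => Real.cos (A i p / 2) * ∏ j ∈ Finset.univ.erase i, S j p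
    with hR
  have hRc : ∀ i, Continuous (R i) := fun i => by fun_prop
  have hGS : ∀ i p, G p * ∏ j, S j p = 2 * r i p * S i p ^ 2 * R i p := by
    intro i p
    rw [← Finset.mul_prod_erase Finset.univ (fun j => S j p) (Finset.mem_univ i), hG i p]
    have : Real.sin (A i p) = 2 * S i p * Real.cos (A i p / 2) := by
      rw [hS, ← Real.sin_two_mul]
      congr 1
      ring
    rw [this, hR]
    ring
  have hpos : ∀ i p, S i p ≠ 0 → (0 < G p * ∏ j, S j p ↔ 0 < R i p) := by
    intro i p h
    have : 0 < 2 * r i p * S i p ^ 2 := by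
      have := hr i p
      positivity
    rw [hGS i p, mul_pos_iff_of_pos_left this]
  have hRS : ∀ i j p, i ≠ j → R i p ≠ 0 → S j p ≠ 0 := by
    intro i j p hij h h0
    exact h (mul_eq_zero_of_right _
      (Finset.prod_eq_zero (Finset.mem_erase.2 ⟨hij.symm, Finset.mem_univ j⟩) h0))
  have hRR : ∀ i j p, 0 < R i p → R j p ≠ 0 → 0 < R j p := by
    intro i j p hi hj
    rcases eq_or_ne i j with rfl | hij
    · exact hi
    · rw [← hpos j p (hRS i j p hij hi.ne'), hpos i p (hRS j i p hij.symm hj)]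
      exact hi
  have hcover : ∀ p, ∃ i, R i p ≠ 0 := by
    intro p
    by_cases h : ∃ i, S i p = 0
    · obtain ⟨i, hi⟩ := h
      refine ⟨i, mul_ne_zero (fun hc => ?_) (Finset.prod_ne_zero_iff.2 fun j hj =>
        hdisj i j p (Finset.ne_of_mem_erase hj).symm hi)⟩
      have := Real.sin_sq_add_cos_sq (A i p / 2)
      rw [hc, show Real.sin (A i p / 2) = 0 from hi] at this
      norm_num at this
    · push Not at h
      refine ⟨i₀, fun h0 => ?_⟩
      have := hGS i₀ p
      rw [h0, mul_zero, mul_eq_zero, Finset.prod_eq_zero_iff] at this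
      rcases this with h1 | ⟨j, -, h1⟩
      · obtain ⟨i, hi⟩ := hG0 p h1
        exact h i hi
      · exact h j h1
  have hclopen : IsClopen {p | ∃ i, 0 < R i p} := by
    constructor
    · rw [← isOpen_compl_iff]
      have : {p | ∃ i, 0 < R i p}ᶜ = ⋃ i, {p | R i p < 0} := by
        ext p
        simp only [mem_compl_iff, mem_ofPred_eq, not_exists, mem_iUnion]
        constructor
        · intro h
          obtain ⟨i, hi⟩ := hcover p
          exact ⟨i, lt_of_le_of_ne (not_lt.1 (h i)) hi⟩
        · rintro ⟨i, hi⟩ j hj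
          exact absurd (hRR j i p hj hi.ne) (not_lt.2 hi.le)
      rw [this]
      exact isOpen_iUnion fun i => isOpen_lt (hRc i) continuous_const
    · simp only [ofPred_exists]
      exact isOpen_iUnion fun i => isOpen_lt continuous_const (hRc i)
  have hsign : ∀ p p', G p ≠ 0 → G p' ≠ 0 → 0 < G p * ∏ j, S j p → 0 < G p' * ∏ j, S j p' := by
    have hS0 : ∀ p, G p ≠ 0 → ∀ i, S i p ≠ 0 := by
      intro p hp i hi
      refine hp ?_
      rw [hG i p, show A i p = 2 * (A i p / 2) by ring, Real.sin_two_mul,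
        show Real.sin (A i p / 2) = 0 from hi]
      ring
    intro p p' hp hp' h
    have hu : {p | ∃ i, 0 < R i p} = univ := (isClopen_iff.1 hclopen).resolve_left
      (Set.Nonempty.ne_empty ⟨p, i₀, (hpos i₀ p (hS0 p hp i₀)).1 h⟩)
    obtain ⟨i, hi⟩ : p' ∈ {p | ∃ i, 0 < R i p} := hu ▸ mem_univ p'
    exact (hpos i p' (hS0 p' hp' i)).2 hi
  have hSe : ∀ p, ∏ j, S j (p + e) = (-1 : ℝ) ^ (∑ i, q i) * ∏ j, S j p := by
    intro p
    have h1 : ∀ j, S j (p + e) = (-1 : ℝ) ^ (q j) * S j p := by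
      intro j
      simp only [hS, hAe]
      rw [show (A j p + 2 * Real.pi * q j) / 2 = A j p / 2 + q j * Real.pi by ring,
        Real.sin_add_int_mul_pi]
    rw [Finset.prod_congr rfl fun j _ => h1 j, Finset.prod_mul_distrib]
    congr 1
    induction (Finset.univ : Finset (Fin k)) using Finset.induction_on with
    | empty => simp
    | insert a s ha ih =>
      rw [Finset.prod_insert ha, Finset.sum_insert ha, ih, zpow_add₀ (by norm_num)]
  by_contra hodd
  rw [Int.not_even_iff_odd] at hodd
  have h1 := hSe p₀
  rw [hodd.neg_one_zpow] at h1
  have hp₀' : G (p₀ + e) ≠ 0 := by rwa [hGe]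
  have h2 := hsign p₀ (p₀ + e) hp₀ hp₀'
  have h3 := hsign (p₀ + e) p₀ hp₀' hp₀
  rw [h1, hGe] at h2 h3
  have hne : G p₀ * ∏ j, S j p₀ ≠ 0 := by
    refine mul_ne_zero hp₀ (Finset.prod_ne_zero_iff.2 fun i _ hi => hp₀ ?_)
    rw [hG i p₀, show A i p₀ = 2 * (A i p₀ / 2) by ring, Real.sin_two_mul,
        show Real.sin (A i p₀ / 2) = 0 from hi]
    ring
  rcases lt_or_gt_of_ne hne with h4 | h4
  · linarith [h3 (by linarith)]
  · linarith [h2 h4]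

/-- The projection of the plane onto the torus. -/
def torusProj (p : ℝ × ℝ) : AddCircle (1 : ℝ) × AddCircle (1 : ℝ) := (p.1, p.2)

lemma continuous_torusProj : Continuous torusProj :=
  ((AddCircle.continuous_mk' 1).comp continuous_fst).prodMk
    ((AddCircle.continuous_mk' 1).comp continuous_snd)

lemma torusProj_eq_iff (p q : ℝ × ℝ) :
    torusProj p = torusProj q ↔ ∃ m n : ℤ, p = q + ((m : ℝ), (n : ℝ)) := by
  simp only [torusProj, coe_addCircle_eq_iff, Prod.ext_iff, Prod.fst_add,
    Prod.snd_add]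
  constructor
  · rintro ⟨⟨m, hm⟩, n, hn⟩
    exact ⟨m, n, hm, hn⟩
  · rintro ⟨m, n, hm, hn⟩
    exact ⟨⟨m, hm⟩, n, hn⟩

lemma torusProj_add_int (p : ℝ × ℝ) (m n : ℤ) :
    torusProj (p + ((m : ℝ), (n : ℝ))) = torusProj p :=
  (torusProj_eq_iff _ _).2 ⟨m, n, rfl⟩

lemma exists_angle {G : ℝ × ℝ → ℝ} (hGc : Continuous G)
    (hGper : ∀ p, ∀ m n : ℤ, G (p + ((m : ℝ), (n : ℝ))) = G p)
    {K B : Set (AddCircle (1 : ℝ) × AddCircle (1 : ℝ))} (hK : IsClosed K) (hB : IsClosed B)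
    (hKB : Disjoint K B) (hG : ∀ p, G p = 0 ↔ torusProj p ∈ K ∪ B) :
    ∃ r A : ℝ × ℝ → ℝ, Continuous A ∧ (∀ p, 0 < r p) ∧
      (∀ p, G p = r p * Real.sin (A p)) ∧ (∀ p, Real.sin (A p / 2) = 0 ↔ torusProj p ∈ K) ∧
      (∃ m : ℤ, ∀ p, A (p + (1, 0)) = A p + 2 * Real.pi * m) ∧
      ∃ n : ℤ, ∀ p, A (p + (0, 1)) = A p + 2 * Real.pi * n := by
  obtain ⟨f, hf0, hf1, -⟩ := exists_continuous_zero_one_of_isClosed hK hB hKB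
  set s : ℝ × ℝ → ℂ := fun p => ((1 / 2 - f (torusProj p) : ℝ) : ℂ) + G p * Complex.I with hs
  have hsc : Continuous s := by
    have := continuous_torusProj
    fun_prop
  have hre : ∀ p, (s p).re = 1 / 2 - f (torusProj p) := fun p => by simp [hs]
  have him : ∀ p, (s p).im = G p := fun p => by simp [hs]
  have hs0 : ∀ p, s p ≠ 0 := by
    intro p hp
    have h1 := hre p
    have h2 := him p
    rw [hp] at h1 h2
    simp only [Complex.zero_re, Complex.zero_im] at h1 h2
    rcases (hG p).1 h2.symm with h3 | h3
    · rw [hf0 h3] at h1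
      norm_num at h1
    · rw [hf1 h3] at h1
      norm_num at h1
  obtain ⟨L, hL, hLe⟩ := exists_continuous_log s hsc hs0
  have hshift : ∀ m n : ℤ, ∃ l : ℤ, ∀ p, (L (p + ((m : ℝ), (n : ℝ)))).im = (L p).im + 2 * Real.pi * l := by
    intro m n
    obtain ⟨l, hl⟩ := exp_eq_const_shift (fun p => L (p + ((m : ℝ), (n : ℝ)))) L (by fun_prop) hL
      (fun p => by
        rw [hLe, hLe]
        simp only [hs, torusProj_add_int, hGper])
    refine ⟨l, fun p => ?_⟩
    rw [hl]
    simp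
    ring
  have hcos : ∀ p, 1 / 2 - f (torusProj p) = Real.exp (L p).re * Real.cos (L p).im := by
    intro p
    rw [← hre, ← hLe, Complex.exp_re]
  have hsin : ∀ p, G p = Real.exp (L p).re * Real.sin (L p).im := by
    intro p
    rw [← him, ← hLe, Complex.exp_im]
  refine ⟨fun p => Real.exp (L p).re, fun p => (L p).im, by fun_prop, fun p => Real.exp_pos _,
    hsin, fun p => ?_, ?_, ?_⟩
  · have e1 := Real.exp_pos (L p).re
    have h1 := hcos p
    have h2 := hsin p
    have h3 : Real.cos (L p).im = 1 - 2 * Real.sin ((L p).im / 2) ^ 2 := by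
      have h4 := Real.cos_two_mul ((L p).im / 2)
      have h5 := Real.sin_sq_add_cos_sq ((L p).im / 2)
      rw [show 2 * ((L p).im / 2) = (L p).im by ring] at h4
      linarith
    constructor
    · intro h
      have h4 : Real.sin (L p).im = 0 := by
        rw [show (L p).im = 2 * ((L p).im / 2) by ring, Real.sin_two_mul, h]
        ring
      rw [h4, mul_zero] at h2
      refine ((hG p).1 h2).resolve_right fun h5 => ?_
      rw [hf1 h5, h3, h] at h1
      simp at h1
      linarith
    · intro h
      rw [(hG p).2 (Or.inl h)] at h2
      have h4 : Real.sin (L p).im = 0 := by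
        rcases mul_eq_zero.1 h2.symm with h5 | h5
        · exact absurd h5 e1.ne'
        · exact h5
      rw [hf0 h] at h1
      have h5 := Real.sin_sq_add_cos_sq (L p).im
      rw [h4] at h5
      have h6 : 0 < Real.cos (L p).im := by
        by_contra h7
        have := mul_nonpos_of_nonneg_of_nonpos e1.le (not_lt.1 h7)
        rw [← h1] at this
        norm_num at this
      have h7 : Real.cos (L p).im = 1 := by nlinarith
      have : Real.sin ((L p).im / 2) ^ 2 = 0 := by linarith
      exact pow_eq_zero_iff (two_ne_zero) |>.1 this
  · simpa using hshift 1 0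
  · simpa using hshift 0 1

lemma exists_degree (f : AddCircle (1 : ℝ) → AddCircle (1 : ℝ)) (hf : Continuous f) :
    ∃ X : ℝ → ℝ, ∃ a : ℤ, Continuous X ∧ (∀ t : ℝ, (X t : AddCircle (1 : ℝ)) = f t) ∧
      ∀ t, X (t + 1) = X t + a := by
  obtain ⟨X, hX, hXf⟩ := exists_lift_addCircle (fun t : ℝ => f t)
    (hf.comp (AddCircle.continuous_mk' 1))
  have h1 : ∀ t, ∃ n : ℤ, X (t + 1) - X t = n := by
    intro t
    have : (X (t + 1) : AddCircle (1 : ℝ)) = X t := by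
      rw [hXf, hXf]
      congr 1
      simp
    obtain ⟨n, hn⟩ := (coe_addCircle_eq_iff _ _).1 this
    exact ⟨n, by linarith⟩
  obtain ⟨a, ha⟩ := eq_const_of_forall_int (fun t => X (t + 1) - X t) (by fun_prop) h1
  exact ⟨X, a, hX, hXf, fun t => by linarith [ha t]⟩

lemma degree_eq_zero_of_homotopic (f : C(AddCircle (1 : ℝ), AddCircle (1 : ℝ)))
    (z : AddCircle (1 : ℝ)) (hfz : f.Homotopic (ContinuousMap.const _ z))
    {X : ℝ → ℝ} (hX : Continuous X) (hXf : ∀ t : ℝ, (X t : AddCircle (1 : ℝ)) = f t)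
    {a : ℤ} (hXa : ∀ t, X (t + 1) = X t + a) : a = 0 := by
  obtain ⟨H⟩ := hfz
  have hcoe : Continuous ((↑) : ℝ → AddCircle (1 : ℝ)) := AddCircle.continuous_mk' 1
  obtain ⟨L, hL, hLH⟩ := exists_lift_addCircle
    (fun p : ℝ × ℝ => H (projIcc (0 : ℝ) 1 zero_le_one p.1, (p.2 : AddCircle (1 : ℝ))))
    (H.continuous.comp ((continuous_projIcc.comp continuous_fst).prodMk
      (hcoe.comp continuous_snd)))
  obtain ⟨n, hn⟩ := eq_const_of_forall_int (fun p : ℝ × ℝ => L (p.1, p.2 + 1) - L p)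
    (by fun_prop) (fun p => by
      have : (L (p.1, p.2 + 1) : AddCircle (1 : ℝ)) = L p := by
        rw [hLH, hLH]
        simp
      obtain ⟨n, hn⟩ := (coe_addCircle_eq_iff _ _).1 this
      exact ⟨n, by linarith⟩)
  obtain ⟨m, hm⟩ := eq_const_of_forall_int (fun t : ℝ => L (0, t) - X t)
    (by fun_prop) (fun t => by
      have : (L (0, t) : AddCircle (1 : ℝ)) = X t := by
        rw [hLH, hXf]
        simp
      obtain ⟨n, hn⟩ := (coe_addCircle_eq_iff _ _).1 this
      exact ⟨n, by linarith⟩)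
  obtain ⟨l, hl⟩ := eq_const_of_forall_int (fun t : ℝ => L (1, t) - L (1, 0))
    (by fun_prop) (fun t => by
      have : (L (1, t) : AddCircle (1 : ℝ)) = L (1, 0) := by
        rw [hLH, hLH]
        simp
      obtain ⟨n, hn⟩ := (coe_addCircle_eq_iff _ _).1 this
      exact ⟨n, by linarith⟩)
  have h1 := hn (0, 0)
  have h2 := hm 0
  have h3 := hm (0 + 1)
  have h4 := hXa 0
  have h5 := hn (1, 0)
  have h6 := hl 0
  have h7 := hl (0 + 1)
  simp only at h1 h2 h3 h5 h6 h7
  have h8 : (a : ℝ) = n := by linarith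
  have h9 : (n : ℝ) = 0 := by linarith
  exact_mod_cast h8.trans h9

lemma exists_real_map_of_periodic {X : ℝ → ℝ} (hX : Continuous X) (hp : ∀ t, X (t + 1) = X t) :
    ∃ f : C(AddCircle (1 : ℝ), ℝ), ∀ t : ℝ, f t = X t := by
  have hper : Function.Periodic X 1 := hp
  exact ⟨⟨hper.lift, hX.quotient_lift _⟩, fun t => hper.lift_coe t⟩

lemma homotopic_const_of_periodic_lift
    (g : C(AddCircle (1 : ℝ), AddCircle (1 : ℝ) × AddCircle (1 : ℝ)))
    {X Y : ℝ → ℝ} (hX : Continuous X) (hY : Continuous Y)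
    (hXY : ∀ t : ℝ, torusProj (X t, Y t) = g t)
    (hXp : ∀ t, X (t + 1) = X t) (hYp : ∀ t, Y (t + 1) = Y t) :
    g.Homotopic (ContinuousMap.const _ (g 0)) := by
  obtain ⟨x, hx⟩ := exists_real_map_of_periodic hX hXp
  obtain ⟨y, hy⟩ := exists_real_map_of_periodic hY hYp
  have h1 : (x.prodMk y).Homotopic (ContinuousMap.const _ (X 0, Y 0)) :=
    ⟨ContinuousMap.Homotopy.affine _ _⟩
  have h2 := (ContinuousMap.Homotopic.refl
    (⟨torusProj, continuous_torusProj⟩ : C(ℝ × ℝ, _))).comp h1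
  convert h2 using 1
  · ext1 t
    obtain ⟨t, rfl⟩ := QuotientAddGroup.mk_surjective t
    change g t = torusProj (x t, y t)
    rw [hx, hy, hXY]
  · ext1 t
    change g 0 = torusProj (X 0, Y 0)
    rw [hXY]
    rfl

lemma exists_floor_of_forall_ne_int {X : Type*} [TopologicalSpace X] [PreconnectedSpace X]
    [Nonempty X] {f : X → ℝ} (hf : Continuous f) (h : ∀ x, ∀ n : ℤ, f x ≠ n) :
    ∃ N : ℤ, ∀ x, f x ∈ Ioo (N : ℝ) (N + 1) := by
  obtain ⟨x₀⟩ := ‹Nonempty X›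
  refine ⟨⌊f x₀⌋, fun x => ⟨?_, ?_⟩⟩
  · by_contra hcon
    obtain ⟨z, hz⟩ := intermediate_value_univ x x₀ hf ⟨not_lt.1 hcon, Int.floor_le _⟩
    exact h z _ hz
  · by_contra hcon
    obtain ⟨z, hz⟩ := intermediate_value_univ x₀ x hf
      ⟨(Int.lt_floor_add_one _).le, not_lt.1 hcon⟩
    exact h z (⌊f x₀⌋ + 1) (by push_cast; exact hz)

lemma odd_iff_mul_neg {f : ℝ → ℝ} (hf : Continuous f) {q : ℤ} (hq : f 1 = f 0 + q)
    (h0 : ∀ n : ℤ, f 0 ≠ n) (hint : ∀ v ∈ Icc (0 : ℝ) 1, ∀ n : ℤ, f v = n → n = 0) :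
    Odd q ↔ f 0 * f 1 < 0 := by
  set N := ⌊f 0⌋ with hN
  have h1 : (N : ℝ) < f 0 := lt_of_le_of_ne (Int.floor_le _) (h0 _).symm
  have h2 : f 0 < N + 1 := Int.lt_floor_add_one _
  have up : ∀ n : ℤ, f 0 ≤ n → (n : ℝ) ≤ f 1 → n = 0 := by
    intro n ha hb
    obtain ⟨v, hv, hvn⟩ := intermediate_value_Icc zero_le_one hf.continuousOn ⟨ha, hb⟩
    exact hint v hv n hvn
  have down : ∀ n : ℤ, f 1 ≤ n → (n : ℝ) ≤ f 0 → n = 0 := by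
    intro n ha hb
    obtain ⟨v, hv, hvn⟩ := intermediate_value_Icc' zero_le_one hf.continuousOn ⟨ha, hb⟩
    exact hint v hv n hvn
  rcases lt_trichotomy q 0 with hq0 | hq0 | hq0
  · have hq1 : (q : ℝ) ≤ -1 := by exact_mod_cast Int.le_sub_one_of_lt hq0
    have hN0 : N = 0 := down N (by linarith) h1.le
    have hqq : q = -1 := by
      by_contra hne
      have hq2 : (q : ℝ) ≤ -2 := by exact_mod_cast (show q ≤ -2 by omega)
      have := down (N - 1) (by push_cast; linarith) (by push_cast; linarith)
      omega
    rw [hN0] at h1 h2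
    subst hqq
    refine ⟨fun _ => ?_, fun _ => by decide⟩
    rw [hq]
    push_cast at *
    nlinarith
  · subst hq0
    simp only [Int.cast_zero, add_zero] at hq
    rw [hq]
    refine ⟨fun h => by simp at h, fun h => absurd h (not_lt.2 (mul_self_nonneg _))⟩
  · have hq1 : (1 : ℝ) ≤ q := by exact_mod_cast hq0
    have hN0 : N + 1 = 0 := up (N + 1) (by push_cast; linarith) (by push_cast; linarith)
    have hqq : q = 1 := by
      by_contra hne
      have hq2 : (2 : ℝ) ≤ q := by exact_mod_cast (show 2 ≤ q by omega)
      have := up (N + 2) (by push_cast; linarith) (by push_cast; linarith)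
      omega
    have hN1 : N = -1 := by omega
    rw [hN1] at h1 h2
    subst hqq
    refine ⟨fun _ => ?_, fun _ => by decide⟩
    rw [hq]
    push_cast at *
    nlinarith

lemma sin_half_eq_zero_iff (x : ℝ) : Real.sin (x / 2) = 0 ↔ ∃ n : ℤ, x / (2 * Real.pi) = n := by
  rw [Real.sin_eq_zero_iff]
  have := Real.pi_pos
  refine exists_congr fun n => ?_
  rw [div_eq_iff (by positivity)]
  constructor <;> intro h <;> linarith

lemma superlevelConnectedAt_of_angle {E : Type*} [NormedAddCommGroup E] [NormedSpace ℝ E]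
    {g r h : E → ℝ} (hh : Continuous h) {q : E} (hr : ∀ p, 0 < r p)
    (hg : ∀ p, g p = r p * Real.sin (h p)) (hq : h q = 0) {l : E →L[ℝ] ℝ} (hl : l ≠ 0)
    (hgl : HasStrictFDerivAt g l q) : SuperlevelConnectedAt h q := by
  have h1 : SuperlevelConnectedAt g q := fun N hN =>
    exists_preconnected_superlevel hgl (by rw [hg, hq]; simp) hl hN
  refine h1.congr ?_
  have hN : h ⁻¹' Ioo (-Real.pi) Real.pi ∈ 𝓝 q :=
    hh.continuousAt.preimage_mem_nhds (Ioo_mem_nhds (by rw [hq]; linarith [Real.pi_pos])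
      (by rw [hq]; exact Real.pi_pos))
  filter_upwards [hN] with p hp
  rw [hg, mul_pos_iff_of_pos_left (hr p)]
  constructor
  · intro h2
    by_contra h3
    exact absurd (Real.sin_nonpos_of_nonpos_of_neg_pi_le (not_lt.1 h3) hp.1.le) (not_le.2 h2)
  · intro h2
    exact Real.sin_pos_of_pos_of_lt_pi h2 hp.2

lemma odd_iff_not_homotopic_of_avoids_diagonal
    (c : C(AddCircle (1 : ℝ), AddCircle (1 : ℝ) × AddCircle (1 : ℝ)))
    (hinj : Function.Injective c) (hdiag : ∀ z, (c z).1 ≠ (c z).2)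
    {G r A : ℝ × ℝ → ℝ} (hA : Continuous A) (hr : ∀ p, 0 < r p)
    (hG : ∀ p, G p = r p * Real.sin (A p))
    (hAc : ∀ p, Real.sin (A p / 2) = 0 ↔ torusProj p ∈ range c)
    {a' q : ℤ} (hA1 : ∀ p, A (p + (1, 0)) = A p + 2 * Real.pi * a')
    (hA2 : ∀ p, A (p + (0, 1)) = A p + 2 * Real.pi * q)
    (hreg : ∀ p, torusProj p ∈ range c → ∃ l : ℝ × ℝ →L[ℝ] ℝ, l ≠ 0 ∧ HasStrictFDerivAt G l p) :
    Odd q ↔ ¬ c.Homotopic (ContinuousMap.const _ (c 0)) := by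
  have hpi : 0 < 2 * Real.pi := by have := Real.pi_pos; positivity
  obtain ⟨X, a, hX, hXc, hXa⟩ := exists_degree (fun z => (c z).1) (by fun_prop)
  obtain ⟨Y₀, b₀, hY₀, hYc₀, hYb₀⟩ := exists_degree (fun z => (c z).2) (by fun_prop)
  have hne : ∀ t, ∀ n : ℤ, Y₀ t - X t ≠ n := by
    intro t n hn
    refine hdiag t ?_
    rw [← hXc, ← hYc₀, eq_comm, coe_addCircle_eq_iff]
    exact ⟨n, by linarith⟩
  obtain ⟨N, hN⟩ := exists_floor_of_forall_ne_int (f := fun t => Y₀ t - X t) (by fun_prop) hne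
  have hab : b₀ = a := by
    have h1 := hN 0
    have h2 := hN (0 + 1)
    rw [hXa, hYb₀] at h2
    have h3 : ((b₀ - a : ℤ) : ℝ) < 1 := by push_cast; linarith [h1.1, h2.2]
    have h4 : (-1 : ℝ) < ((b₀ - a : ℤ) : ℝ) := by push_cast; linarith [h1.2, h2.1]
    have h5 : b₀ - a < 1 := by exact_mod_cast h3
    have h6 : -1 < b₀ - a := by exact_mod_cast h4
    omega
  subst hab
  set w : ℝ → ℝ × ℝ := fun t => (X t, Y₀ t - N - X t) with hw
  have hwc : Continuous w := by fun_prop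
  have hw01 : ∀ t, (w t).2 ∈ Ioo (0 : ℝ) 1 := fun t =>
    ⟨by have := (hN t).1; simp only [hw]; linarith, by have := (hN t).2; simp only [hw]; linarith⟩
  have hwa : ∀ t, w (t + 1) = w t + ((b₀ : ℝ), 0) := by
    intro t
    simp only [hw, hXa, hYb₀]
    ext
    · simp
    · simp; ring
  set S : ℝ × ℝ → ℝ × ℝ := fun p => (p.1, p.1 + p.2) with hS
  have hSc : Continuous S := by fun_prop
  have hSw : ∀ t : ℝ, torusProj (S (w t)) = c t := by
    intro t
    have : S (w t) = (X t, Y₀ t) + (((0 : ℤ) : ℝ), ((-N : ℤ) : ℝ)) := by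
      ext
      · simp [hS, hw]
      · simp [hS, hw]; ring
    rw [this, torusProj_add_int]
    exact Prod.ext (hXc t) (hYc₀ t)
  have hAint : ∀ p, (∃ n : ℤ, A p / (2 * Real.pi) = n) ↔ torusProj p ∈ range c := fun p => by
    rw [← hAc, sin_half_eq_zero_iff]
  obtain ⟨n₀, hn₀⟩ := eq_const_of_forall_int (fun t => A (S (w t)) / (2 * Real.pi))
    (by fun_prop) (fun t => (hAint _).2 (by rw [hSw]; exact mem_range_self _))
  set h : ℝ × ℝ → ℝ := fun p => A (S p) - 2 * Real.pi * n₀ with hh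
  have hc : Continuous h := by fun_prop
  have hwz : ∀ t, h (w t) = 0 := fun t => by
    have := (div_eq_iff hpi.ne').1 (hn₀ t)
    simp only [hh]
    linarith
  have hS11 : ∀ p, A (S (p + (1, 0))) = A (S p) + 2 * Real.pi * (a' + q : ℤ) := by
    intro p
    have : S (p + (1, 0)) = S p + (1, 0) + (0, 1) := by
      ext
      · simp [hS]
      · simp [hS]; ring
    rw [this, hA2, hA1]
    push_cast
    ring
  have hdiag' : ∀ u v : ℝ, ∀ n : ℤ, v = n → torusProj (S (u, v)) ∉ range c := by
    rintro u v n rfl ⟨z, hz⟩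
    refine hdiag z ?_
    rw [hz]
    change (u : AddCircle (1 : ℝ)) = ((u + n : ℝ) : AddCircle (1 : ℝ))
    rw [eq_comm, coe_addCircle_eq_iff]
    exact ⟨n, rfl⟩
  have haq : a' + q = 0 := by
    obtain ⟨M, hM⟩ := exists_floor_of_forall_ne_int
      (f := fun u : ℝ => A (S (u, 0)) / (2 * Real.pi)) (by fun_prop)
      (fun u n hn => hdiag' u 0 0 (by simp) ((hAint _).1 ⟨n, hn⟩))
    have h1 := hM 0
    have h2 := hM 1
    have h3 := hS11 (0, 0)
    simp only [Prod.mk_add_mk, zero_add, add_zero] at h3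
    rw [h3, add_div, mul_div_cancel_left₀ _ hpi.ne'] at h2
    have h4 : (((a' + q : ℤ)) : ℝ) < 1 := by linarith [h1.1, h2.2]
    have h5 : (-1 : ℝ) < ((a' + q : ℤ) : ℝ) := by linarith [h1.2, h2.1]
    have h6 : a' + q < 1 := by exact_mod_cast h4
    have h7 : -1 < a' + q := by exact_mod_cast h5
    omega
  have hper1 : ∀ p, h (p + (1, 0)) = h p := by
    intro p
    simp only [hh, hS11, haq]
    simp
  have hper : ∀ p, ∀ m : ℤ, h (p + ((m : ℝ), 0)) = h p := by
    intro p m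
    have hpr : Function.Periodic (fun u => h (u, p.2)) 1 := fun u => by
      simpa using hper1 (u, p.2)
    have := hpr.int_mul m p.1
    simpa [Prod.add_def] using this
  have hpt : ∀ p : ℝ × ℝ, p.2 ∈ Icc (0 : ℝ) 1 → torusProj (S p) ∈ range c →
      ∃ t, ∃ m : ℤ, p = w t + ((m : ℝ), 0) := by
    rintro p hp ⟨z, hz⟩
    obtain ⟨t, rfl⟩ := QuotientAddGroup.mk_surjective z
    have hz' : torusProj (S p) = torusProj (S (w t)) := by rw [hSw]; exact hz.symm
    obtain ⟨m, n, hmn⟩ := (torusProj_eq_iff _ _).1 hz'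
    have h1 : p.1 = (w t).1 + m := by simpa [hS] using congrArg Prod.fst hmn
    have h2 : p.1 + p.2 = (w t).1 + (w t).2 + n := by simpa [hS] using congrArg Prod.snd hmn
    have h3 := hw01 t
    have h4 : ((n - m : ℤ) : ℝ) < 1 := by push_cast; linarith [h3.1, hp.2]
    have h5 : (-1 : ℝ) < ((n - m : ℤ) : ℝ) := by push_cast; linarith [h3.2, hp.1]
    have h6 : n - m < 1 := by exact_mod_cast h4
    have h7 : -1 < n - m := by exact_mod_cast h5
    have h8 : n = m := by omega
    refine ⟨t, m, Prod.ext (by simpa using h1) ?_⟩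
    rw [h8] at h2
    simp
    linarith
  have hrange : ∀ p, h p = 0 → torusProj (S p) ∈ range c := by
    intro p hp
    refine (hAint _).1 ⟨n₀, ?_⟩
    rw [div_eq_iff hpi.ne']
    simp only [hh] at hp
    linarith
  have hzero : ∀ p : ℝ × ℝ, p.2 ∈ Icc (0 : ℝ) 1 →
      (h p = 0 ↔ ∃ t, ∃ m : ℤ, p = w t + ((m : ℝ), 0)) := by
    intro p hp
    constructor
    · exact fun h0 => hpt p hp (hrange p h0)
    · rintro ⟨t, m, rfl⟩
      rw [hper, hwz]
  have hh1 : ∀ u, h (u, 1) = h (u, 0) + 2 * Real.pi * q := by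
    intro u
    have : S (u, 1) = S (u, 0) + (0, 1) := by ext <;> simp [hS]
    simp only [hh, this, hA2]
    ring
  have hint : ∀ p, (∃ n : ℤ, h p / (2 * Real.pi) = n) → torusProj (S p) ∈ range c := by
    rintro p ⟨n, hn⟩
    refine (hAint _).1 ⟨n + n₀, ?_⟩
    rw [div_eq_iff hpi.ne'] at hn ⊢
    simp only [hh] at hn
    push_cast
    linarith
  have hodd : Odd q ↔ h (0, 0) * h (0, 1) < 0 := by
    rw [odd_iff_mul_neg (f := fun v => h (0, v) / (2 * Real.pi)) (by fun_prop) (q := q)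
      (by rw [hh1]; field_simp)
      (fun n hn => hdiag' 0 0 0 (by simp) (hint _ ⟨n, hn⟩))
      (fun v hv n hn => by
        obtain ⟨t, m, htm⟩ := hpt (0, v) hv (hint _ ⟨n, hn⟩)
        rw [htm, hper, hwz] at hn
        simpa using hn.symm)]
    rw [div_mul_div_comm, div_lt_iff₀ (by positivity), zero_mul]
  have hnez : ∀ u v : ℝ, (v = 0 ∨ v = 1) → h (u, v) ≠ 0 := by
    rintro u v (rfl | rfl) h0
    · exact hdiag' u 0 0 (by simp) (hrange _ h0)
    · exact hdiag' u 1 1 (by simp) (hrange _ h0)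
  rw [hodd]
  constructor
  · intro hneg hhom
    have h1 : (ContinuousMap.fst.comp c).Homotopic (ContinuousMap.const _ (c 0).1) :=
      (ContinuousMap.Homotopic.refl (ContinuousMap.fst)).comp hhom
    have hb0 := degree_eq_zero_of_homotopic _ _ h1 hX hXc hXa
    subst hb0
    obtain ⟨x, hx⟩ := exists_real_map_of_periodic hX (fun t => by simpa using hXa t)
    obtain ⟨e, he⟩ := x.exists_extension (c.continuous.isClosedEmbedding hinj)
    have he' : ∀ z, e (c z) = x z := fun z => DFunLike.congr_fun he z
    have hEc : Continuous fun p => e (torusProj (S p)) :=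
      e.continuous.comp (continuous_torusProj.comp hSc)
    have hEper : ∀ p, e (torusProj (S (p + (1, 0)))) = e (torusProj (S p)) := by
      intro p
      congr 1
      refine (torusProj_eq_iff _ _).2 ⟨1, 1, ?_⟩
      ext
      · simp [hS]
      · simp [hS]; ring
    have hEz : ∀ p : ℝ × ℝ, p.2 ∈ Icc (0 : ℝ) 1 → h p = 0 →
        ∃ n : ℤ, e (torusProj (S p)) = p.1 + n := by
      intro p hp h0
      obtain ⟨t, m, rfl⟩ := (hzero p hp).1 h0
      refine ⟨-m, ?_⟩
      have : torusProj (S (w t + ((m : ℝ), 0))) = torusProj (S (w t)) := by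
        refine (torusProj_eq_iff _ _).2 ⟨m, m, ?_⟩
        ext
        · simp [hS]
        · simp [hS]; ring
      rw [this, hSw, he', hx]
      simp [hw]
    have hs0 := forall_pos_or_forall_neg (f := fun u => h (u, 0)) (by fun_prop)
      (fun u => hnez u 0 (Or.inl rfl))
    have hs1 := forall_pos_or_forall_neg (f := fun u => h (u, 1)) (by fun_prop)
      (fun u => hnez u 1 (Or.inr rfl))
    rcases hs0 with hs0 | hs0 <;> rcases hs1 with hs1 | hs1
    · exact absurd hneg (not_lt.2 (mul_pos (hs0 0) (hs1 0)).le)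
    · exact not_neg_pos_of_extension (h := fun p => - h p) hc.neg (fun p m => by rw [hper]) hEc
        hEper (fun p hp h0 => hEz p hp (neg_eq_zero.1 h0)) (fun u => by linarith [hs0 u])
        (fun u => by linarith [hs1 u])
    · exact not_neg_pos_of_extension hc hper hEc hEper hEz hs0 hs1
    · exact absurd hneg (not_lt.2 (mul_pos_of_neg_of_neg (hs0 0) (hs1 0)).le)
  · intro hhom
    have hb0 : b₀ ≠ 0 := by
      rintro rfl
      exact hhom (homotopic_const_of_periodic_lift c hX hY₀
        (fun t => Prod.ext (hXc t) (hYc₀ t)) (fun t => by simpa using hXa t)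
        (fun t => by simpa using hYb₀ t))
    have hgh : ∀ p, G (S p) = r (S p) * Real.sin (h p) := by
      intro p
      rw [hG]
      congr 1
      simp only [hh]
      rw [mul_comm (2 * Real.pi), Real.sin_sub_int_mul_two_pi]
    have hder : ∀ p, h p = 0 → ∃ l : ℝ × ℝ →L[ℝ] ℝ, l ≠ 0 ∧
        HasStrictFDerivAt (fun p => G (S p)) l p := by
      intro p hp
      obtain ⟨l, hl, hGl⟩ := hreg _ (hrange p hp)
      set S' : ℝ × ℝ →L[ℝ] ℝ × ℝ := (ContinuousLinearMap.fst ℝ ℝ ℝ).prod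
        (ContinuousLinearMap.fst ℝ ℝ ℝ + ContinuousLinearMap.snd ℝ ℝ ℝ) with hS'
      have hSS : HasStrictFDerivAt S S' p := S'.hasStrictFDerivAt
      refine ⟨l.comp S', fun h0 => hl ?_, hGl.comp p hSS⟩
      ext1
      · ext
        have := DFunLike.congr_fun h0 (1, -1)
        simpa [hS'] using this
      · ext
        have := DFunLike.congr_fun h0 (0, 1)
        simpa [hS'] using this
    refine mul_neg_of_ne_zero hc hper hwc hw01 hzero hwa (fun p hp => ?_) (fun p hp => ?_) hb0
    · obtain ⟨l, hl, hGl⟩ := hder p hp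
      exact superlevelConnectedAt_of_angle hc (fun p => hr (S p)) hgh hp hl hGl
    · obtain ⟨l, hl, hGl⟩ := hder p hp
      exact superlevelConnectedAt_of_angle (g := fun p => - G (S p)) (h := fun p => - h p) hc.neg
        (fun p => hr (S p)) (fun p => by rw [hgh, Real.sin_neg]; ring) (by rw [hp, neg_zero])
        (neg_ne_zero.2 hl) hGl.neg

lemma degree_ne_zero_of_injective {f : AddCircle (1 : ℝ) → AddCircle (1 : ℝ)}
    (hf : Function.Injective f) {X : ℝ → ℝ} (hX : Continuous X)
    (hXf : ∀ t : ℝ, (X t : AddCircle (1 : ℝ)) = f t) {a : ℤ}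
    (hXa : ∀ t, X (t + 1) = X t + a) : a ≠ 0 := by
  rintro rfl
  obtain ⟨t, ht⟩ : ∃ t, X (t + 1 / 2) - X t = 0 := by
    set k : ℝ → ℝ := fun t => X (t + 1 / 2) - X t with hk
    have hkc : Continuous k := by fun_prop
    have h1 : k (1 / 2) = - k 0 := by
      have h2 := hXa 0
      simp only [hk]
      norm_num at h2 ⊢
      rw [h2]
    rcases le_total (k 0) 0 with h | h
    · have h2 : 0 ≤ k (1 / 2) := by linarith
      exact mem_range_of_exists_le_of_exists_ge hkc ⟨0, h⟩ ⟨1 / 2, h2⟩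
    · have h2 : k (1 / 2) ≤ 0 := by linarith
      exact mem_range_of_exists_le_of_exists_ge hkc ⟨1 / 2, h2⟩ ⟨0, h⟩
  have h1 : ((t + 1 / 2 : ℝ) : AddCircle (1 : ℝ)) = t := by
    apply hf
    rw [← hXf, ← hXf, sub_eq_zero.1 ht]
  obtain ⟨n, hn⟩ := (coe_addCircle_eq_iff _ _).1 h1
  have h2 : ((2 * n : ℤ) : ℝ) = (1 : ℤ) := by push_cast; linarith
  have h3 : 2 * n = 1 := by exact_mod_cast h2
  omega

lemma AddCircle.surjective_of_continuous_of_injective {f : AddCircle (1 : ℝ) → AddCircle (1 : ℝ)}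
    (hf : Continuous f) (hinj : Function.Injective f) : Function.Surjective f := by
  obtain ⟨X, a, hX, hXf, hXa⟩ := exists_degree f hf
  have ha := degree_ne_zero_of_injective hinj hX hXf hXa
  intro z
  obtain ⟨x, rfl⟩ := QuotientAddGroup.mk_surjective z
  have hle : |X 0 - x| ≤ ⌈|X 0 - x|⌉₊ := Nat.le_ceil _
  have hn : ∀ n : ℤ, X n = X 0 + n * a := by
    intro n
    have hp : Function.Periodic (fun t => X t - t * a) 1 := fun t => by
      simp only [hXa]
      ring
    have := hp.int_mul n 0
    simp only [mul_one, zero_add, zero_mul, sub_zero] at this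
    linarith
  obtain ⟨t, ht⟩ : x ∈ range X := by
    have h1 := hn (a * ⌈|X 0 - x|⌉₊)
    have h2 := hn (-(a * ⌈|X 0 - x|⌉₊))
    have h3 : (1 : ℝ) ≤ a * a := by
      have : 1 ≤ a * a := by
        rcases lt_or_gt_of_ne ha with h | h <;> nlinarith
      exact_mod_cast this
    have h4 : (⌈|X 0 - x|⌉₊ : ℝ) ≤ a * a * ⌈|X 0 - x|⌉₊ :=
      le_mul_of_one_le_left (Nat.cast_nonneg _) h3
    have h5 := abs_le.1 (hle.trans h4)
    refine mem_range_of_exists_le_of_exists_ge hX ⟨_, h2.le.trans ?_⟩ ⟨_, le_trans ?_ h1.ge⟩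
    · push_cast; linarith [h5.2]
    · push_cast; linarith [h5.1]
  exact ⟨t, by rw [← hXf, ht]⟩

lemma odd_of_deriv_eq_mul_sin {Φ r α : ℝ → ℝ} (hΦ : Differentiable ℝ Φ) (h0 : Φ 0 = 0)
    (h1 : Φ 1 = 0) (hpos : ∀ y ∈ Ioo (0 : ℝ) 1, 0 < Φ y) (hr : ∀ y, 0 < r y)
    (hα : Continuous α) (hderiv : ∀ y, deriv Φ y = r y * Real.sin (α y))
    (hα0 : Real.sin (α 0 / 2) = 0) (hα1 : ∀ y ∈ Ioo (0 : ℝ) 1, Real.sin (α y / 2) ≠ 0) {q : ℤ}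
    (hq : α 1 = α 0 + 2 * Real.pi * q) : Odd q := by
  have hpi := Real.pi_pos
  have : Nonempty (Ioo (0 : ℝ) 1) := ⟨⟨1 / 2, by norm_num, by norm_num⟩⟩
  have : PreconnectedSpace (Ioo (0 : ℝ) 1) := Subtype.preconnectedSpace isPreconnected_Ioo
  obtain ⟨N, hN⟩ := exists_floor_of_forall_ne_int
    (f := fun y : Ioo (0 : ℝ) 1 => α y / (2 * Real.pi)) (by fun_prop)
    (fun y n hn => hα1 y y.2 ((sin_half_eq_zero_iff _).2 ⟨n, hn⟩))
  have hN' : ∀ y ∈ Ioo (0 : ℝ) 1, 2 * Real.pi * N < α y ∧ α y < 2 * Real.pi * N + 2 * Real.pi := by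
    intro y hy
    have := hN ⟨y, hy⟩
    simp only [mem_Ioo] at this
    rw [lt_div_iff₀ (by positivity), div_lt_iff₀ (by positivity)] at this
    constructor <;> linarith [this.1, this.2]
  have hcl : ∀ y ∈ Icc (0 : ℝ) 1, α y ∈ Icc (2 * Real.pi * N) (2 * Real.pi * N + 2 * Real.pi) := by
    rw [← closure_Ioo (zero_ne_one (α := ℝ))]
    exact closure_minimal (fun y hy => mem_preimage.2 ⟨(hN' y hy).1.le, (hN' y hy).2.le⟩)
      (isClosed_Icc.preimage hα)
  obtain ⟨n, hn⟩ := (sin_half_eq_zero_iff _).1 hα0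
  rw [div_eq_iff (by positivity)] at hn
  have hint : ∀ m : ℤ, m * (2 * Real.pi) ∈ Icc (2 * Real.pi * N) (2 * Real.pi * N + 2 * Real.pi) →
      m = N ∨ m = N + 1 := by
    rintro m ⟨ha, hb⟩
    have ha' : (N : ℝ) ≤ m := by nlinarith
    have hb' : (m : ℝ) ≤ (N + 1 : ℤ) := by push_cast; nlinarith
    have ha'' : N ≤ m := by exact_mod_cast ha'
    have hb'' : m ≤ N + 1 := by exact_mod_cast hb'
    omega
  have hn' := hint n (hn ▸ hcl 0 (by simp))
  have hnq := hint (n + q) (by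
    have := hcl 1 (by simp)
    rw [hq, hn] at this
    convert this using 1
    push_cast
    ring)
  by_contra hodd
  have hq0 : q = 0 := by
    rw [Int.not_odd_iff_even, Int.even_iff] at hodd
    omega
  subst hq0
  rcases hn' with rfl | rfl
  · have h2 : ∀ᶠ y in 𝓝[<] (1 : ℝ), α y < 2 * Real.pi * n + Real.pi :=
      (hα.continuousAt.eventually_lt_const (by rw [hq, hn]; simp; linarith)).filter_mono
        nhdsWithin_le_nhds
    obtain ⟨l, hl, hlα⟩ := mem_nhdsLT_iff_exists_Ioo_subset.1 h2
    have hl1 : max l 0 < 1 := max_lt hl one_pos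
    obtain ⟨u, hu, hu1⟩ := exists_between hl1
    obtain ⟨y, hy, hyu⟩ := exists_deriv_eq_slope Φ hu1 hΦ.continuous.continuousOn
      hΦ.differentiableOn
    have hy0 : 0 < y := (le_max_right l 0).trans_lt (hu.trans hy.1)
    have h3 := hlα ⟨(le_max_left l 0).trans_lt (hu.trans hy.1), hy.2⟩
    have h4 := (hN' y ⟨hy0, hy.2⟩).1
    have h5 : 0 < deriv Φ y := by
      rw [hderiv, ← Real.sin_sub_int_mul_two_pi _ n]
      refine mul_pos (hr y) (Real.sin_pos_of_pos_of_lt_pi (by linarith) ?_)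
      simp only [mem_ofPred_eq] at h3
      linarith
    have h6 := hpos u ⟨(le_max_right l 0).trans_lt hu, hu1⟩
    rw [hyu, h1] at h5
    exact absurd h5 (not_lt.2 (div_nonpos_of_nonpos_of_nonneg (by linarith) (by linarith)))
  · have h2 : ∀ᶠ y in 𝓝[>] (0 : ℝ), 2 * Real.pi * N + Real.pi < α y :=
      (hα.continuousAt.eventually_const_lt (by rw [hn]; push_cast; linarith)).filter_mono
        nhdsWithin_le_nhds
    obtain ⟨l, hl, hlα⟩ := mem_nhdsGT_iff_exists_Ioo_subset.1 h2
    have hl1 : 0 < min l 1 := lt_min hl one_pos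
    obtain ⟨u, hu, hu1⟩ := exists_between hl1
    obtain ⟨y, hy, hyu⟩ := exists_deriv_eq_slope Φ hu hΦ.continuous.continuousOn
      hΦ.differentiableOn
    have hy1 : y < 1 := hy.2.trans (hu1.trans_le (min_le_right _ _))
    have h3 := hlα ⟨hy.1, hy.2.trans (hu1.trans_le (min_le_left _ _))⟩
    have h4 := (hN' y ⟨hy.1, hy1⟩).2
    have h5 : deriv Φ y < 0 := by
      rw [hderiv, ← Real.sin_sub_int_mul_two_pi _ (N + 1)]
      refine mul_neg_of_pos_of_neg (hr y) (Real.sin_neg_of_neg_of_neg_pi_lt ?_ ?_)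
      · push_cast; linarith
      · simp only [mem_ofPred_eq] at h3
        push_cast; linarith
    have h6 := hpos u ⟨hu, hu1.trans_le (min_le_right _ _)⟩
    rw [hyu, h0] at h5
    exact absurd h5 (not_lt.2 (div_nonneg (by linarith) (by linarith)))

lemma fst_eq_snd_of_diagonal_subset
    (c : C(AddCircle (1 : ℝ), AddCircle (1 : ℝ) × AddCircle (1 : ℝ)))
    (hinj : Function.Injective c) (hD : ∀ z, (z, z) ∈ range c) (z : AddCircle (1 : ℝ)) :
    (c z).1 = (c z).2 := by
  choose f hf using hD
  have hfc : Continuous f := by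
    rw [(c.continuous.isClosedEmbedding hinj).isEmbedding.continuous_iff]
    have : c ∘ f = fun z => (z, z) := funext hf
    rw [this]
    fun_prop
  have hfi : Function.Injective f := fun x y hxy => by
    have := congrArg c hxy
    rw [hf, hf] at this
    exact congrArg Prod.fst this
  obtain ⟨w, rfl⟩ := AddCircle.surjective_of_continuous_of_injective hfc hfi z
  rw [hf]

lemma not_homotopic_const_of_fst_injective
    (c : C(AddCircle (1 : ℝ), AddCircle (1 : ℝ) × AddCircle (1 : ℝ)))
    (hinj : Function.Injective fun z => (c z).1) (p : AddCircle (1 : ℝ) × AddCircle (1 : ℝ)) :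
    ¬ c.Homotopic (ContinuousMap.const _ p) := by
  intro hhom
  obtain ⟨X, a, hX, hXf, hXa⟩ := exists_degree (fun z => (c z).1) (by fun_prop)
  have h1 : (ContinuousMap.fst.comp c).Homotopic (ContinuousMap.const _ p.1) :=
    (ContinuousMap.Homotopic.refl (ContinuousMap.fst)).comp hhom
  exact degree_ne_zero_of_injective hinj hX hXf hXa
    (degree_eq_zero_of_homotopic _ _ h1 hX hXf hXa)

lemma exists_forall_mem_of_preconnected {X Y ι : Type*} [TopologicalSpace X] [PreconnectedSpace X]
    [Nonempty X] [TopologicalSpace Y] [Finite ι] {C : ι → Set Y} (hC : ∀ i, IsClosed (C i))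
    (hdisj : ∀ i j, i ≠ j → Disjoint (C i) (C j)) {d : X → Y} (hd : Continuous d)
    (hmem : ∀ x, d x ∈ ⋃ i, C i) : ∃ i, ∀ x, d x ∈ C i := by
  simp only [mem_iUnion] at hmem
  choose f hf using hmem
  have hfx : ∀ i, f ⁻¹' {i} = d ⁻¹' C i := by
    intro i
    ext x
    refine ⟨fun h => ?_, fun h => ?_⟩
    · have : f x = i := h
      exact this ▸ hf x
    · by_contra hne
      exact disjoint_left.1 (hdisj _ _ hne) (hf x) h
  let : TopologicalSpace ι := ⊥
  have : DiscreteTopology ι := ⟨rfl⟩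
  have hfc : Continuous f := by
    refine continuous_iff_isClosed.2 fun s _ => ?_
    rw [← biUnion_preimage_singleton]
    exact s.toFinite.isClosed_biUnion fun i _ => hfx i ▸ (hC i).preimage hd
  obtain ⟨x₀⟩ := ‹Nonempty X›
  exact ⟨f x₀, fun x => PreconnectedSpace.constant ‹_› hfc (x := x) (y := x₀) ▸ hf x⟩

lemma even_sum_iff_even_ncard_odd {ι : Type*} [Fintype ι] (q : ι → ℤ) :
    Even (∑ i, q i) ↔ Even {i | Odd (q i)}.ncard := by
  classical
  have h1 : Even (∑ i, q i) ↔ Even (∑ i, (q i).natAbs) := by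
    induction (Finset.univ : Finset ι) using Finset.induction with
    | empty => simp
    | insert i s hi ih => rw [Finset.sum_insert hi, Finset.sum_insert hi, Int.even_add,
        Nat.even_add, Int.natAbs_even, ih]
  rw [h1, Finset.even_sum_iff_even_card_odd, ncard_eq_toFinset_card']
  simp [Set.toFinset_ofPred]

end TorusCurves

open Set Topology in
/-- Let `f : S¹ × S¹ → ℝ` (modeled by a doubly `1`-periodic smooth
function `F` on `ℝ²`) be a smooth function vanishing exactly on the diagonal and
positive elsewhere, such that `0` is a regular value of `∂f/∂y` away from the
diagonal and the critical set `Z = {(x,y) | ∂f/∂y = 0}` is a finite disjoint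
union of simple closed curves `γ i` in the torus.  Then `Z` contains an even
number of homotopically essential (not null-homotopic) simple closed curves. -/
theorem stmt_1 (F : ℝ → ℝ → ℝ)
    (hF : ContDiff ℝ (⊤ : ℕ∞) (fun p : ℝ × ℝ => F p.1 p.2))
    (hper1 : ∀ x y : ℝ, F (x + 1) y = F x y)
    (hper2 : ∀ x y : ℝ, F x (y + 1) = F x y)
    (hzero : ∀ x y : ℝ, F x y = 0 ↔ x - y ∈ Set.range (Int.cast : ℤ → ℝ))
    (hpos : ∀ x y : ℝ, 0 ≤ F x y)
    (hreg : ∀ x y : ℝ, deriv (F x) y = 0 → ¬ (x - y ∈ Set.range (Int.cast : ℤ → ℝ)) →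
      fderiv ℝ (fun p : ℝ × ℝ => deriv (F p.1) p.2) (x, y) ≠ 0)
    (k : ℕ) (γ : Fin k → C(AddCircle (1:ℝ), AddCircle (1:ℝ) × AddCircle (1:ℝ)))
    (hinj : ∀ i, Function.Injective (γ i))
    (hdisj : ∀ i j, i ≠ j → Disjoint (Set.range (γ i)) (Set.range (γ j)))
    (hZ : ∀ x y : ℝ, deriv (F x) y = 0 ↔
      ((↑x : AddCircle (1:ℝ)), (↑y : AddCircle (1:ℝ))) ∈ ⋃ i, Set.range (γ i)) :
    Even {i : Fin k |
      ¬ (γ i).Homotopic (ContinuousMap.const _ ((γ i) 0))}.ncard := by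
  set G : ℝ × ℝ → ℝ := fun p => deriv (F p.1) p.2 with hG
  have hFd : ∀ x y, HasDerivAt (F x) (fderiv ℝ (fun p : ℝ × ℝ => F p.1 p.2) (x, y) (0, 1)) y :=
    fun x y => ((hF.differentiable (by simp)) (x, y)).hasFDerivAt.comp_hasDerivAt y
      ((hasDerivAt_const y x).prodMk (hasDerivAt_id y))
  have hGs : ContDiff ℝ 1 G := by
    have : G = fun p => fderiv ℝ (fun p : ℝ × ℝ => F p.1 p.2) p (0, 1) :=
      funext fun p => (hFd p.1 p.2).deriv
    rw [this]
    exact (hF.fderiv_right (m := 1) (by norm_cast)).clm_apply contDiff_const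
  have hGc : Continuous G := hGs.continuous
  have hGs' : ∀ p, HasStrictFDerivAt G (fderiv ℝ G p) p := fun p =>
    hGs.contDiffAt.hasStrictFDerivAt one_ne_zero
  have hper1' : Function.Periodic F 1 := fun x => funext (hper1 x)
  have hper2' : ∀ x, Function.Periodic (F x) 1 := hper2
  have hGper : ∀ p, ∀ m n : ℤ, G (p + ((m : ℝ), (n : ℝ))) = G p := by
    intro p m n
    have h1 : F (p.1 + m) = F p.1 := by simpa using hper1'.int_mul m p.1
    have h2 : (fun y => F p.1 (y + n)) = F p.1 :=
      funext fun y => by simpa using (hper2' p.1).int_mul n y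
    simp only [hG, Prod.fst_add, Prod.snd_add, h1]
    rw [← deriv_comp_add_const, h2]
  have hmem : ∀ x y : ℝ, x - y ∈ range (Int.cast : ℤ → ℝ) ↔
      (x : AddCircle (1 : ℝ)) = (y : AddCircle (1 : ℝ)) := by
    intro x y
    rw [coe_addCircle_eq_iff]
    exact ⟨fun ⟨n, hn⟩ => ⟨n, by linarith⟩, fun ⟨n, hn⟩ => ⟨n, by linarith⟩⟩
  have hF0 : ∀ x, F x x = 0 := fun x => (hzero x x).2 ((hmem x x).2 rfl)
  have hdiag : ∀ z : AddCircle (1 : ℝ), (z, z) ∈ ⋃ i, range (γ i) := by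
    intro z
    obtain ⟨x, rfl⟩ := QuotientAddGroup.mk_surjective z
    refine (hZ x x).1 (IsLocalMin.deriv_eq_zero (Filter.Eventually.of_forall fun y => ?_))
    rw [hF0]
    exact hpos x y
  have hcl : ∀ i, IsClosed (range (γ i)) := fun i =>
    (isCompact_range (γ i).continuous).isClosed
  obtain ⟨i₀, hi₀⟩ := exists_forall_mem_of_preconnected hcl hdisj (d := fun z => (z, z))
    (by fun_prop) hdiag
  have hi₀' := fst_eq_snd_of_diagonal_subset (γ i₀) (hinj i₀) hi₀
  have hangle := fun i => exists_angle hGc hGper (hcl i)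
    (isClosed_iUnion_of_finite fun j : {j // j ≠ i} => hcl j)
    (disjoint_iUnion_right.2 fun j : {j // j ≠ i} => hdisj i j j.2.symm)
    (fun p => by
      rw [hG]
      simp only
      rw [hZ p.1 p.2]
      change torusProj p ∈ _ ↔ _
      constructor
      · intro h
        obtain ⟨j, hj⟩ := mem_iUnion.1 h
        by_cases hji : j = i
        · exact Or.inl (hji ▸ hj)
        · exact Or.inr (mem_iUnion.2 ⟨⟨j, hji⟩, hj⟩)
      · rintro (h | h)
        · exact mem_iUnion.2 ⟨i, h⟩
        · obtain ⟨j, hj⟩ := mem_iUnion.1 h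
          exact mem_iUnion.2 ⟨j, hj⟩)
  choose r A hAc hr hGA hA0 hA1 hA2 using hangle
  choose m hm using hA1
  choose q hq using hA2
  have hpos' : ∀ y ∈ Ioo (0 : ℝ) 1, 0 < F 0 y := by
    intro y hy
    refine lt_of_le_of_ne (hpos 0 y) fun h => ?_
    obtain ⟨n, hn⟩ := (hzero 0 y).1 h.symm
    have h1 : (n : ℝ) < (0 : ℤ) := by push_cast; linarith [hy.1]
    have h2 : ((-1 : ℤ) : ℝ) < n := by push_cast; linarith [hy.2]
    have h3 : n < 0 := by exact_mod_cast h1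
    have h4 : -1 < n := by exact_mod_cast h2
    omega
  have hodd : ∀ i, Odd (q i) ↔ ¬ (γ i).Homotopic (ContinuousMap.const _ ((γ i) 0)) := by
    intro i
    by_cases hi : i = i₀
    · subst hi
      refine iff_of_true ?_ (not_homotopic_const_of_fst_injective _ (fun x y hxy => ?_) _)
      · refine odd_of_deriv_eq_mul_sin (Φ := F 0) (r := fun y => r i (0, y))
          (α := fun y => A i (0, y)) (fun y => (hFd 0 y).differentiableAt) (hF0 0)
          (by simpa [hF0] using hper2 0 0) hpos' (fun y => hr i _)
          ((hAc i).comp (by fun_prop)) (fun y => hGA i (0, y)) ((hA0 i _).2 (hi₀ 0))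
          (fun y hy h => ?_) (by simpa using hq i (0, 0))
        obtain ⟨z, hz⟩ := (hA0 i _).1 h
        have h1 := hi₀' z
        rw [hz] at h1
        exact (hpos' y hy).ne' ((hzero 0 y).2 ((hmem 0 y).2 h1))
      · refine hinj i (Prod.ext hxy ?_)
        rw [← hi₀', ← hi₀']
        exact hxy
    · have hne : ∀ z, (γ i z).1 ≠ (γ i z).2 := fun z hz =>
        disjoint_left.1 (hdisj i i₀ hi) (mem_range_self z)
          ((Prod.ext rfl hz : ((γ i z).1, (γ i z).1) = γ i z) ▸ hi₀ (γ i z).1)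
      refine odd_iff_not_homotopic_of_avoids_diagonal (γ i) (hinj i) hne (hAc i) (hr i) (hGA i)
        (hA0 i) (hm i) (hq i) (fun p hp => ⟨_, hreg p.1 p.2 ?_ ?_, hGs' p⟩)
      · exact (hZ p.1 p.2).2 (mem_iUnion.2 ⟨i, hp⟩)
      · rw [hmem]
        intro h
        obtain ⟨z, hz⟩ := hp
        exact hne z (by rw [hz]; exact h)
  obtain ⟨y, hy, hy'⟩ := exists_deriv_eq_slope (F 0) (show (0 : ℝ) < 1 / 2 by norm_num)
    (fun y _ => (hFd 0 y).continuousAt.continuousWithinAt)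
    (fun y _ => (hFd 0 y).differentiableAt.differentiableWithinAt)
  have hGy : G (0, y) ≠ 0 := by
    have h1 := hpos' (1 / 2) (by norm_num)
    change deriv (F 0) y ≠ 0
    rw [hy', hF0]
    norm_num
    norm_num at h1
    exact h1.ne'
  have key := even_sum_of_shift i₀ hAc hr hGA
    (fun i j p hij hi hj => disjoint_left.1 (hdisj i j hij) ((hA0 i p).1 hi) ((hA0 j p).1 hj))
    (fun p hp => by
      obtain ⟨i, hi⟩ := mem_iUnion.1 ((hZ p.1 p.2).1 hp)
      exact ⟨i, (hA0 i p).2 hi⟩)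
    (e := (0, 1)) (fun p => by simpa using hGper p 0 1) hq hGy
  simpa only [← hodd] using (even_sum_iff_even_ncard_odd q).1 key
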